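/- arXiv:2502.16904 — 4 statements merged into one kernel-verified Lean document; each statement's English description precedes it below -/
import Mathlib

section
/- Let g ∈ ℝ³ with |g| ≤ 1, and let x₀, x₁ : (0,1] → ℝ³ be sufficiently smooth with ‖x₀‖_{X³} < ∞ and ‖x₁‖_{X²} < ∞. Suppose τ₀ ∈ C²([0,1]) solves the two-point boundary value problem -τ₀''(s) + |x₀''(s)|² τ₀(s) = |x₁'(s)|² on (0,1), τ₀(0) = 0, τ₀'(1) = -g·x₀'(1), and set x₂ := (τ₀ x₀')' + g. Then: (i) ‖τ₀'‖_{L^∞(0,1)} ≤ C(‖x₀‖_{X³}) ( ‖x₀‖_{X²} + ‖x₁‖_{X²}² ) for some nondecreasing function C; (ii) for every ε > 0 there is a constant C' depending only on ε, ‖x₀‖_{X³} and ‖x₁‖_{X²} such that ‖x₂‖_{L²(0,1)} + (∫₀¹ s^{1+2ε} |x₂'(s)|² ds)^{1/2} ≤ C'. In particular x₂ belongs to the space X¹_ε for every ε > 0. -/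
open MeasureTheory ENNReal RealInnerProductSpace

noncomputable section

/-- The weighted L² norm `‖s^α v‖_{L²(0,1)} = (∫₀¹ s^{2α} ‖v s‖² ds)^{1/2}`, valued in `[0,∞]`. -/
def wL2 {E : Type*} [NormedAddCommGroup E] (α : ℝ) (v : ℝ → E) : ℝ≥0∞ :=
  (∫⁻ s in Set.Ioo (0:ℝ) 1, ENNReal.ofReal (s ^ (2 * α) * ‖v s‖ ^ 2)) ^ ((1:ℝ) / 2)

/-- The weighted L^∞ norm `‖s^α v‖_{L^∞(0,1)} = sup_{0<s<1} s^α ‖v s‖`, valued in `[0,∞]`. -/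
def wLinf {E : Type*} [NormedAddCommGroup E] (α : ℝ) (v : ℝ → E) : ℝ≥0∞ :=
  ⨆ s : Set.Ioo (0:ℝ) 1, ENNReal.ofReal ((s : ℝ) ^ α * ‖v (s : ℝ)‖)

/-- The square of the weighted Sobolev norm `X^m` on `(0,1)`:
for `m = 2k`, `‖u‖_{X^m}² = Σ_{i=0}^{k} ‖∂^i u‖² + Σ_{j=1}^{k} ‖s^j ∂^{k+j} u‖²`;
for `m = 2k+1`, `‖u‖_{X^m}² = Σ_{i=0}^{k} ‖∂^i u‖² + Σ_{j=1}^{k+1} ‖s^{j-1/2} ∂^{k+j} u‖²`. -/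
def XnormSq {E : Type*} [NormedAddCommGroup E] [NormedSpace ℝ E] (m : ℕ) (u : ℝ → E) : ℝ≥0∞ :=
  if m % 2 = 0 then
    (∑ i ∈ Finset.range (m / 2 + 1), wL2 0 (iteratedDeriv i u) ^ 2) +
      ∑ j ∈ Finset.range (m / 2), wL2 ((j : ℝ) + 1) (iteratedDeriv (m / 2 + j + 1) u) ^ 2
  else
    (∑ i ∈ Finset.range (m / 2 + 1), wL2 0 (iteratedDeriv i u) ^ 2) +
      ∑ j ∈ Finset.range (m / 2 + 1), wL2 ((j : ℝ) + 1 / 2) (iteratedDeriv (m / 2 + j + 1) u) ^ 2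

/-- The weighted Sobolev norm `X^m`, valued in `[0,∞]`. -/
def Xnorm {E : Type*} [NormedAddCommGroup E] [NormedSpace ℝ E] (m : ℕ) (u : ℝ → E) : ℝ≥0∞ :=
  XnormSq m u ^ ((1:ℝ) / 2)

/-- The square of the companion weighted Sobolev norm `Y^m` on `(0,1)`:
for `m = 2k`, `‖u‖_{Y^m}² = Σ_{i=0}^{k-1} ‖∂^i u‖² + Σ_{j=1}^{k+1} ‖s^{j-1/2} ∂^{k+j-1} u‖²`;
for `m = 2k+1`, `‖u‖_{Y^m}² = Σ_{i=0}^{k} ‖∂^i u‖² + Σ_{j=1}^{k+1} ‖s^{j} ∂^{k+j} u‖²`. -/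
def YnormSq {E : Type*} [NormedAddCommGroup E] [NormedSpace ℝ E] (m : ℕ) (u : ℝ → E) : ℝ≥0∞ :=
  if m % 2 = 0 then
    (∑ i ∈ Finset.range (m / 2), wL2 0 (iteratedDeriv i u) ^ 2) +
      ∑ j ∈ Finset.range (m / 2 + 1), wL2 ((j : ℝ) + 1 / 2) (iteratedDeriv (m / 2 + j) u) ^ 2
  else
    (∑ i ∈ Finset.range (m / 2 + 1), wL2 0 (iteratedDeriv i u) ^ 2) +
      ∑ j ∈ Finset.range (m / 2 + 1), wL2 ((j : ℝ) + 1) (iteratedDeriv (m / 2 + j + 1) u) ^ 2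

/-- The weighted Sobolev norm `Y^m`, valued in `[0,∞]`. -/
def Ynorm {E : Type*} [NormedAddCommGroup E] [NormedSpace ℝ E] (m : ℕ) (u : ℝ → E) : ℝ≥0∞ :=
  YnormSq m u ^ ((1:ℝ) / 2)


open Set

lemma aux_incr {E : Type*} [NormedAddCommGroup E] [NormedSpace ℝ E] [CompleteSpace E]
    (F F' : ℝ → E) (D : ℝ → ℝ)
    (hF : ∀ s, 0 < s → HasDerivAt F (F' s) s) (hc : ContinuousOn F' (Ioi 0))
    (hD : IntegrableOn D (Ioo 0 1)) (hD0 : ∀ s ∈ Ioo (0:ℝ) 1, 0 ≤ D s)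
    (a b : ℝ) (ha : 0 < a) (hab : a ≤ b) (hb : b ≤ 1)
    (hFD : ∀ s ∈ Ioo a b, ‖F' s‖ ≤ D s) :
    ‖F b - F a‖ ≤ ∫ s in Ioo (0:ℝ) 1, D s := by
  have hint : IntervalIntegrable F' volume a b := by
    apply ContinuousOn.intervalIntegrable
    apply hc.mono
    rw [uIcc_of_le hab]
    intro x hx
    exact lt_of_lt_of_le ha hx.1
  have h1 : ∫ s in a..b, F' s = F b - F a := by
    apply intervalIntegral.integral_eq_sub_of_hasDerivAt _ hint
    intro x hx
    rw [uIcc_of_le hab] at hx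
    exact hF x (lt_of_lt_of_le ha hx.1)
  rw [← h1]
  refine (intervalIntegral.norm_integral_le_integral_norm hab).trans ?_
  rw [intervalIntegral.integral_of_le hab, integral_Ioc_eq_integral_Ioo]
  have hsub : Ioo a b ⊆ Ioo 0 1 := Ioo_subset_Ioo ha.le hb
  refine (setIntegral_mono_on ?_ (hD.mono_set hsub) measurableSet_Ioo hFD).trans ?_
  · have := hint.norm
    rw [intervalIntegrable_iff_integrableOn_Ioc_of_le hab] at this
    exact this.mono_set Ioo_subset_Ioc_self
  · apply setIntegral_mono_set hD
    · filter_upwards [ae_restrict_mem measurableSet_Ioo] with x hx using hD0 x hx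
    · exact hsub.eventuallyLE

lemma aux_key (p p' D : ℝ → ℝ)
    (hp : ∀ s, 0 < s → HasDerivAt p (p' s) s) (hc : ContinuousOn p' (Ioi 0))
    (hD : IntegrableOn D (Ioo 0 1))
    (hpD : ∀ s ∈ Ioo (0:ℝ) 1, |p' s| ≤ D s) (hpi : IntegrableOn p (Ioo 0 1))
    (s : ℝ) (hs : s ∈ Ioc (0:ℝ) 1) :
    p s ≤ (∫ r in Ioo (0:ℝ) 1, p r) + ∫ r in Ioo (0:ℝ) 1, D r := by
  have hD0 : ∀ s ∈ Ioo (0:ℝ) 1, 0 ≤ D s := fun s hs => (abs_nonneg _).trans (hpD s hs)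
  have h : ∀ r ∈ Ioo (0:ℝ) 1, p s - ∫ r in Ioo (0:ℝ) 1, D r ≤ p r := by
    intro r hr
    rcases le_total r s with h | h
    · have := aux_incr p p' D hp hc hD hD0 r s hr.1 h hs.2
        (fun x hx => hpD x ⟨hr.1.trans hx.1, hx.2.trans_le hs.2⟩)
      have := (abs_le.1 this).2
      linarith
    · have := aux_incr p p' D hp hc hD hD0 s r hs.1 h hr.2.le
        (fun x hx => hpD x ⟨hs.1.trans hx.1, hx.2.trans hr.2⟩)
      have := (abs_le.1 this).1
      linarith
  have := setIntegral_mono_on (μ := volume) (integrableOn_const (by simp)) hpi measurableSet_Ioo h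
  simp at this
  linarith

lemma aux_sup {E : Type*} [NormedAddCommGroup E] [InnerProductSpace ℝ E]
    (k : ℕ) (u u' : ℝ → E) (hu : ∀ s, 0 < s → HasDerivAt u (u' s) s)
    (hc : ContinuousOn u' (Ioi 0))
    (h1 : IntegrableOn (fun s => s ^ k * ‖u s‖ ^ 2) (Ioo 0 1))
    (h2 : IntegrableOn (fun s => s ^ (k+2) * ‖u' s‖ ^ 2) (Ioo 0 1))
    (s : ℝ) (hs : s ∈ Ioc (0:ℝ) 1) :
    s ^ (k+1) * ‖u s‖ ^ 2 ≤ (k+3) * (∫ s in Ioo (0:ℝ) 1, s ^ k * ‖u s‖ ^ 2) +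
      ∫ s in Ioo (0:ℝ) 1, s ^ (k+2) * ‖u' s‖ ^ 2 := by
  have huc : ContinuousOn u (Ioi 0) := fun x hx => (hu x hx).continuousAt.continuousWithinAt
  have hle : ∀ s ∈ Ioo (0:ℝ) 1, s ^ (k+1) * ‖u s‖ ^ 2 ≤ s ^ k * ‖u s‖ ^ 2 := by
    intro s hs
    apply mul_le_mul_of_nonneg_right _ (by positivity)
    exact pow_le_pow_of_le_one hs.1.le hs.2.le (by omega)
  have hpi : IntegrableOn (fun s => s ^ (k+1) * ‖u s‖ ^ 2) (Ioo 0 1) := by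
    refine Integrable.mono' h1 ?_ ?_
    · apply ContinuousOn.aestronglyMeasurable _ measurableSet_Ioo
      have := huc.mono (fun x (hx : x ∈ Ioo (0:ℝ) 1) => hx.1)
      fun_prop
    · filter_upwards [ae_restrict_mem measurableSet_Ioo] with x hx
      rw [Real.norm_of_nonneg (by have := hx.1; positivity)]
      exact hle x hx
  have := aux_key (fun s => s ^ (k+1) * ‖u s‖ ^ 2)
    (fun s => ((k+1 : ℕ) * s ^ k) * ‖u s‖ ^ 2 + s ^ (k+1) * (2 * ⟪u s, u' s⟫))
    (fun s => (k+2) * (s ^ k * ‖u s‖ ^ 2) + s ^ (k+2) * ‖u' s‖ ^ 2) ?_ ?_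
    (by exact (h1.const_mul _).add h2) ?_ hpi s hs
  · have h3 := setIntegral_mono_on hpi h1 measurableSet_Ioo hle
    rw [integral_add (h1.const_mul _) h2, integral_const_mul] at this
    linarith
  · intro s hs
    exact (hasDerivAt_pow (k+1) s).mul (hu s hs).norm_sq
  · fun_prop
  · intro s hs
    have h0 := hs.1
    have hi := abs_real_inner_le_norm (u s) (u' s)
    have e : s ^ (k+1) * (2 * (‖u s‖ * ‖u' s‖)) ≤ s ^ k * ‖u s‖ ^ 2 + s ^ (k+2) * ‖u' s‖ ^ 2 := by
      have : 0 ≤ s ^ k * (‖u s‖ - s * ‖u' s‖) ^ 2 := by positivity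
      have e2 : s ^ k * (‖u s‖ - s * ‖u' s‖) ^ 2 = s ^ k * ‖u s‖ ^ 2 + s ^ (k+2) * ‖u' s‖ ^ 2
          - s ^ (k+1) * (2 * (‖u s‖ * ‖u' s‖)) := by ring
      linarith
    refine (abs_add_le _ _).trans ?_
    rw [abs_of_nonneg (by positivity), abs_mul, abs_of_pos (by positivity : 0 < s ^ (k+1)), abs_mul,
      abs_two]
    have : s ^ (k+1) * (2 * |⟪u s, u' s⟫|) ≤ s ^ (k+1) * (2 * (‖u s‖ * ‖u' s‖)) := by gcongr
    push_cast
    nlinarith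

lemma aux_max (ψ ψ1 ψ2 : ℝ → ℝ) (h0 : ψ 0 = 0)
    (hd : ∀ s, HasDerivAt ψ (ψ1 s) s)
    (hd2 : ∀ s ∈ Ioo (0:ℝ) 1, HasDerivAt ψ1 (ψ2 s) s) (h1 : 0 < ψ1 1)
    (hneg : ∀ s ∈ Ioo (0:ℝ) 1, ψ s < 0 → ψ2 s < 0) : ∀ s ∈ Icc (0:ℝ) 1, 0 ≤ ψ s := by
  have hcont : Continuous ψ := continuous_iff_continuousAt.2 fun s => (hd s).continuousAt
  obtain ⟨m, hm, hmin⟩ := isCompact_Icc.exists_isMinOn (nonempty_Icc.2 zero_le_one) hcont.continuousOn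
  intro s hs
  by_contra! hlt
  have hmneg : ψ m < 0 := (hmin hs).trans_lt hlt
  have hm0 : 0 < m := by
    rcases hm.1.eq_or_lt with h | h
    · rw [← h, h0] at hmneg; exact absurd hmneg (lt_irrefl _)
    · exact h
  rcases hm.2.eq_or_lt with h | hm1
  · -- endpoint
    rw [h] at hmin hmneg
    have : ∀ᶠ x in nhdsWithin 1 (Iio 1), ψ x < ψ 1 := by
      have hs := (hasDerivAt_iff_tendsto_slope_left_right.1 (hd 1)).1
      filter_upwards [hs.eventually (lt_mem_nhds h1), self_mem_nhdsWithin] with x hx hx1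
      rw [slope_def_field] at hx
      have hx1' : x - 1 < 0 := sub_neg.2 hx1
      rw [_root_.div_pos_iff] at hx
      rcases hx with hx | hx <;> linarith [hx.1, hx.2]
    have h2 : ∀ᶠ x in nhdsWithin (1:ℝ) (Iio 1), x ∈ Ioo (0:ℝ) 1 :=
      Ioo_mem_nhdsLT zero_lt_one
    obtain ⟨x, hx, hx2⟩ := (this.and h2).exists
    exact absurd (hmin ⟨hx2.1.le, hx2.2.le⟩) (not_le.2 hx)
  · have hmI : m ∈ Ioo (0:ℝ) 1 := ⟨hm0, hm1⟩
    have hloc : IsLocalMin ψ m := hmin.isLocalMin (Icc_mem_nhds hm0 hm1)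
    have hder : deriv ψ = ψ1 := funext fun s => (hd s).deriv
    have h2 : deriv (deriv ψ) m < 0 := by rw [hder, (hd2 m hmI).deriv]; exact hneg m hmI hmneg
    have hmax := isLocalMax_of_deriv_deriv_neg h2 hloc.deriv_eq_zero hcont.continuousAt
    have hconst : ∀ᶠ x in nhds m, ψ x = ψ m := by
      filter_upwards [hloc, hmax] with x h1 h2 using le_antisymm h2 h1
    have : ψ1 =ᶠ[nhds m] fun _ => 0 := by
      rw [← hder]
      filter_upwards [Filter.Eventually.eventually_nhds hconst] with x hx
      have : ψ =ᶠ[nhds x] fun _ => ψ m := hx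
      rw [this.deriv_eq]; simp
    have h3 := this.deriv_eq
    rw [(hd2 m hmI).deriv] at h3
    have := hneg m hmI hmneg
    simp at h3
    linarith

lemma aux_tau1 (q f τ τ1 τ2 : ℝ → ℝ) (a : ℝ) (ha : 0 ≤ a)
    (hfc : ContinuousOn f (Ioi 0)) (hf0 : ∀ s, 0 ≤ f s) (hfi : IntegrableOn f (Ioo 0 1))
    (hq0 : ∀ s, 0 ≤ q s) (h1 : ∀ s, HasDerivAt τ (τ1 s) s) (h2 : ∀ s, HasDerivAt τ1 (τ2 s) s)
    (heq : ∀ s ∈ Ioo (0:ℝ) 1, q s * τ s - f s ≤ τ2 s) (h0 : τ 0 = 0) (h11 : τ1 1 ≤ a) :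
    ∀ s ∈ Icc (0:ℝ) 1, τ s ≤ s * (a + ∫ r in Ioo (0:ℝ) 1, f r) := by
  set I := ∫ r in Ioo (0:ℝ) 1, f r with hI
  set ft := (Ioo (0:ℝ) 1).indicator f with hft
  have hfti : Integrable ft := (integrable_indicator_iff measurableSet_Ioo).2 hfi
  have hft0 : ∀ s, 0 ≤ ft s := fun s => indicator_nonneg (fun _ _ => hf0 _) s
  set Φ : ℝ → ℝ := fun s => ∫ r in (0:ℝ)..s, ft r with hΦ
  have hΦc : Continuous Φ := intervalIntegral.continuous_primitive
    (fun a b => hfti.intervalIntegrable) 0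
  have hΦ1 : Φ 1 = I := by
    rw [hΦ]
    simp only
    rw [intervalIntegral.integral_of_le zero_le_one, integral_Ioc_eq_integral_Ioo, hI]
    exact setIntegral_congr_fun measurableSet_Ioo (fun x hx => indicator_of_mem hx f)
  have hΦ0 : ∀ s, 0 ≤ s → 0 ≤ Φ s := fun s hs =>
    intervalIntegral.integral_nonneg hs (fun _ _ => hft0 _)
  have hΦI : ∀ s, s ≤ 1 → Φ s ≤ I := by
    intro s hs
    have e : Φ s + ∫ r in s..1, ft r = Φ 1 :=
      intervalIntegral.integral_add_adjacent_intervals hfti.intervalIntegrable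
        hfti.intervalIntegrable
    have : 0 ≤ ∫ r in s..1, ft r := intervalIntegral.integral_nonneg hs (fun _ _ => hft0 _)
    linarith
  have hΦd : ∀ s ∈ Ioo (0:ℝ) 1, HasDerivAt Φ (f s) s := by
    intro s hs
    have hfe : ft =ᶠ[nhds s] f := by
      filter_upwards [Ioo_mem_nhds hs.1 hs.2] with x hx using indicator_of_mem hx f
    have hca : ContinuousAt ft s :=
      ((hfc.continuousAt (Ioi_mem_nhds hs.1)).congr hfe.symm)
    have := intervalIntegral.integral_hasDerivAt_right (a := 0) (hfti.intervalIntegrable)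
      (hfti.aestronglyMeasurable.stronglyMeasurableAtFilter) hca
    rwa [hfe.eq_of_nhds] at this
  set φ : ℝ → ℝ := fun s => ∫ r in (0:ℝ)..s, (I - Φ r) with hφ
  have hIc : Continuous fun r => I - Φ r := by fun_prop
  have hφd : ∀ s, HasDerivAt φ (I - Φ s) s := fun s => hIc.integral_hasStrictDerivAt 0 s |>.hasDerivAt
  have hφ0 : ∀ s ∈ Icc (0:ℝ) 1, 0 ≤ φ s := fun s hs =>
    intervalIntegral.integral_nonneg hs.1 (fun x hx => by linarith [hΦI x (hx.2.trans hs.2)])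
  have hφI : ∀ s ∈ Icc (0:ℝ) 1, φ s ≤ s * I := by
    intro s hs
    have := intervalIntegral.integral_mono_on (μ := volume) hs.1 (hIc.intervalIntegrable 0 s)
      (continuous_const (y := I) |>.intervalIntegrable 0 s)
      (fun x hx => by linarith [hΦ0 x hx.1])
    simpa using this
  have key : ∀ δ : ℝ, 0 < δ → ∀ s ∈ Icc (0:ℝ) 1,
      0 ≤ a * s + φ s + δ * (3 * s - s ^ 2) - τ s := by
    intro δ hδ
    apply aux_max _ (fun s => a + (I - Φ s) + δ * (3 - 2 * s) - τ1 s)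
      (fun s => - f s + δ * (- 2) - τ2 s)
    · simp [h0, hφ]
    · intro s
      have := ((((hasDerivAt_id s).const_mul a).add (hφd s)).add
        ((((hasDerivAt_id s).const_mul 3).sub (hasDerivAt_pow 2 s)).const_mul δ)).sub (h1 s)
      refine (this.congr_deriv ?_)
      simp
    · intro s hs
      have := ((((hΦd s hs).const_sub I).const_add a).add
        ((((hasDerivAt_id s).const_mul 2).const_sub 3).const_mul δ)).sub (h2 s)
      refine (this.congr_deriv ?_)
      simp
    · rw [hΦ1]; linarith
    · intro s hs hneg
      have hτ : 0 ≤ τ s := by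
        have := hφ0 s ⟨hs.1.le, hs.2.le⟩
        have : 0 ≤ a * s := mul_nonneg ha hs.1.le
        have : 0 ≤ δ * (3 * s - s ^ 2) := mul_nonneg hδ.le (by nlinarith [hs.1, hs.2])
        linarith
      have := heq s hs
      have := mul_nonneg (hq0 s) hτ
      linarith
  intro s hs
  have : τ s ≤ a * s + φ s := by
    apply _root_.le_of_forall_pos_le_add
    intro ε hε
    have h := key (ε / 2) (by positivity) s hs
    have : 3 * s - s ^ 2 ≤ 2 := by nlinarith [hs.1, hs.2]
    nlinarith
  have := hφI s hs
  linarith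

lemma aux_tau (q f τ : ℝ → ℝ) (a : ℝ)
    (hfc : ContinuousOn f (Ioi 0)) (hf0 : ∀ s, 0 ≤ f s) (hfi : IntegrableOn f (Ioo 0 1))
    (hq0 : ∀ s, 0 ≤ q s) (hqi : IntegrableOn (fun s => s * q s) (Ioo 0 1))
    (hτ : ContDiff ℝ 2 τ)
    (heq : ∀ s ∈ Ioo (0:ℝ) 1, deriv (deriv τ) s = q s * τ s - f s) (h0 : τ 0 = 0)
    (h11 : |deriv τ 1| ≤ a) :
    (∀ s ∈ Icc (0:ℝ) 1, |τ s| ≤ (a + ∫ r in Ioo (0:ℝ) 1, f r) * s) ∧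
    (∀ s ∈ Ioo (0:ℝ) 1, |deriv τ s| ≤
      (1 + ∫ s in Ioo (0:ℝ) 1, s * q s) * (a + ∫ r in Ioo (0:ℝ) 1, f r)) := by
  have ha : 0 ≤ a := (abs_nonneg _).trans h11
  have h1 : ∀ s, HasDerivAt τ (deriv τ s) s := fun s =>
    (hτ.differentiable (by norm_num) s).hasDerivAt
  have hτ1 : ContDiff ℝ 1 (deriv τ) := by
    have : ContDiff ℝ (1 + 1) τ := by simpa [one_add_one_eq_two] using hτ
    exact (contDiff_succ_iff_deriv.1 this).2.2
  have h2 : ∀ s, HasDerivAt (deriv τ) (deriv (deriv τ) s) s := fun s =>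
    (hτ1.differentiable (by norm_num) s).hasDerivAt
  have hc2 : Continuous (deriv (deriv τ)) := hτ1.continuous_deriv le_rfl
  have hA : ∀ s ∈ Icc (0:ℝ) 1, |τ s| ≤ (a + ∫ r in Ioo (0:ℝ) 1, f r) * s := by
    intro s hs
    have p := aux_tau1 q f τ _ _ a ha hfc hf0 hfi hq0 h1 h2 (fun s hs => (heq s hs).ge) h0
      ((le_abs_self _).trans h11) s hs
    have m := aux_tau1 q f (fun s => - τ s) _ _ a ha hfc hf0 hfi hq0 (fun s => (h1 s).neg)
      (fun s => (h2 s).neg) (fun s hs => by rw [heq s hs]; linarith [hf0 s]) (by simp [h0])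
      ((neg_le_abs _).trans h11) s hs
    rw [abs_le]
    constructor <;> linarith
  refine ⟨hA, fun s hs => ?_⟩
  set A := a + ∫ r in Ioo (0:ℝ) 1, f r with hAdef
  have hA0 : 0 ≤ A := add_nonneg ha (setIntegral_nonneg measurableSet_Ioo fun x _ => hf0 x)
  have := aux_incr (deriv τ) (deriv (deriv τ)) (fun s => A * (s * q s) + f s) (fun s _ => h2 s)
    hc2.continuousOn (by exact (hqi.const_mul A).add hfi)
    (fun s hs => add_nonneg (mul_nonneg hA0 (mul_nonneg hs.1.le (hq0 s))) (hf0 s)) s 1 hs.1 hs.2.le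
    le_rfl ?_
  · rw [integral_add (hqi.const_mul A) hfi, integral_const_mul, Real.norm_eq_abs] at this
    have t := abs_sub_abs_le_abs_sub (deriv τ s) (deriv τ 1)
    rw [abs_sub_comm] at t
    have : 0 ≤ ∫ s in Ioo (0:ℝ) 1, s * q s :=
      setIntegral_nonneg measurableSet_Ioo fun x hx => mul_nonneg hx.1.le (hq0 x)
    linarith
  · intro x hx
    have hx' : x ∈ Ioo (0:ℝ) 1 := ⟨hs.1.trans hx.1, hx.2⟩
    rw [heq x hx', Real.norm_eq_abs]
    refine (abs_sub _ _).trans ?_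
    rw [abs_of_nonneg (hf0 x), abs_mul, abs_of_nonneg (hq0 x)]
    have := mul_le_mul_of_nonneg_left (hA x ⟨hx'.1.le, hx'.2.le⟩) (hq0 x)
    linarith

lemma wL2_sq {E : Type*} [NormedAddCommGroup E] (α : ℝ) (v : ℝ → E) :
    wL2 α v ^ 2 = ∫⁻ s in Set.Ioo (0:ℝ) 1, ENNReal.ofReal (s ^ (2 * α) * ‖v s‖ ^ 2) := by
  unfold wL2
  rw [← ENNReal.rpow_natCast, ← ENNReal.rpow_mul]
  norm_num

lemma Xnorm_sq {E : Type*} [NormedAddCommGroup E] [NormedSpace ℝ E] (m : ℕ) (u : ℝ → E) :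
    Xnorm m u ^ 2 = XnormSq m u := by
  unfold Xnorm
  rw [← ENNReal.rpow_natCast, ← ENNReal.rpow_mul]
  norm_num

lemma XnormSq_three {E : Type*} [NormedAddCommGroup E] [NormedSpace ℝ E] (u : ℝ → E) :
    XnormSq 3 u = wL2 0 u ^ 2 + wL2 0 (deriv u) ^ 2 + (wL2 (1/2) (deriv (deriv u)) ^ 2
      + wL2 (3/2) (deriv (deriv (deriv u))) ^ 2) := by
  unfold XnormSq
  have : (1:ℝ) + 2⁻¹ = 3 / 2 := by norm_num
  simp [Finset.sum_range_succ, iteratedDeriv_succ, this]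

lemma XnormSq_two {E : Type*} [NormedAddCommGroup E] [NormedSpace ℝ E] (u : ℝ → E) :
    XnormSq 2 u = wL2 0 u ^ 2 + wL2 0 (deriv u) ^ 2 + wL2 1 (deriv (deriv u)) ^ 2 := by
  unfold XnormSq
  simp [Finset.sum_range_succ, iteratedDeriv_succ]

lemma Xnorm_two_le {E : Type*} [NormedAddCommGroup E] [NormedSpace ℝ E] (u : ℝ → E) :
    Xnorm 2 u ≤ Xnorm 3 u := by
  unfold Xnorm
  apply ENNReal.rpow_le_rpow _ (by norm_num)
  rw [XnormSq_two, XnormSq_three]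
  gcongr
  refine le_trans ?_ le_self_add
  rw [wL2_sq, wL2_sq]
  apply setLIntegral_mono' measurableSet_Ioo
  intro s hs
  apply ENNReal.ofReal_le_ofReal
  apply mul_le_mul_of_nonneg_right _ (by positivity)
  exact Real.rpow_le_rpow_of_exponent_ge hs.1 hs.2.le (by norm_num)

lemma wL2_int {E : Type*} [NormedAddCommGroup E] (α : ℝ) (n : ℕ) (hn : 2 * α = n) (v : ℝ → E)
    (hv : ContinuousOn v (Ioi 0)) (K : ℝ) (hK : 0 ≤ K) (h : wL2 α v ^ 2 ≤ ENNReal.ofReal K) :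
    IntegrableOn (fun s => s ^ n * ‖v s‖ ^ 2) (Ioo 0 1) ∧
      ∫ s in Ioo (0:ℝ) 1, s ^ n * ‖v s‖ ^ 2 ≤ K := by
  rw [wL2_sq, hn] at h
  simp only [Real.rpow_natCast] at h
  have hm : AEStronglyMeasurable (fun s => s ^ n * ‖v s‖ ^ 2) (volume.restrict (Ioo 0 1)) := by
    apply ContinuousOn.aestronglyMeasurable _ measurableSet_Ioo
    have := hv.mono (fun x (hx : x ∈ Ioo (0:ℝ) 1) => hx.1)
    fun_prop
  have h0 : 0 ≤ᵐ[volume.restrict (Ioo (0:ℝ) 1)] (fun s => s ^ n * ‖v s‖ ^ 2) := by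
    filter_upwards [ae_restrict_mem measurableSet_Ioo] with x hx
    have := hx.1
    simp only [Pi.zero_apply]
    positivity
  constructor
  · refine ⟨hm, ?_⟩
    rw [hasFiniteIntegral_iff_ofReal h0]
    exact h.trans_lt ENNReal.ofReal_lt_top
  · rw [integral_eq_lintegral_of_nonneg_ae h0 hm]
    exact ENNReal.toReal_le_of_le_ofReal hK h

lemma wL2_bound {E : Type*} [NormedAddCommGroup E] (α : ℝ) (v : ℝ → E) (h : ℝ → ℝ) (K : ℝ)
    (hi : IntegrableOn h (Ioo 0 1)) (hK : ∫ s in Ioo (0:ℝ) 1, h s ≤ K)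
    (hv : ∀ s ∈ Ioo (0:ℝ) 1, s ^ (2 * α) * ‖v s‖ ^ 2 ≤ h s) :
    wL2 α v ≤ ENNReal.ofReal (K + 1) := by
  have h0 : ∀ s ∈ Ioo (0:ℝ) 1, 0 ≤ h s := fun s hs =>
    le_trans (by have := hs.1; positivity) (hv s hs)
  have hK0 : 0 ≤ K := (setIntegral_nonneg measurableSet_Ioo h0).trans hK
  have e : wL2 α v ^ 2 ≤ ENNReal.ofReal (K + 1) ^ 2 := by
    rw [wL2_sq]
    calc _ ≤ ∫⁻ s in Ioo (0:ℝ) 1, ENNReal.ofReal (h s) :=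
          setLIntegral_mono' measurableSet_Ioo fun s hs => ENNReal.ofReal_le_ofReal (hv s hs)
      _ = ENNReal.ofReal (∫ s in Ioo (0:ℝ) 1, h s) := by
          rw [ofReal_integral_eq_lintegral_ofReal hi]
          filter_upwards [ae_restrict_mem measurableSet_Ioo] with x hx using h0 x hx
      _ ≤ ENNReal.ofReal ((K + 1) ^ 2) := ENNReal.ofReal_le_ofReal (by nlinarith)
      _ = _ := ENNReal.ofReal_pow (by positivity) 2
  exact (ENNReal.pow_le_pow_left_iff two_ne_zero).1 e

lemma aux_smooth {E : Type*} [NormedAddCommGroup E] [NormedSpace ℝ E] (u : ℝ → E)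
    (hu : ContDiffOn ℝ (⊤ : ℕ∞) u (Ioi 0)) :
    ContDiffOn ℝ (⊤ : ℕ∞) (deriv u) (Ioi 0) ∧ ContinuousOn u (Ioi 0) ∧
    ∀ s, 0 < s → HasDerivAt u (deriv u s) s := by
  refine ⟨hu.deriv_of_isOpen isOpen_Ioi (by simp), hu.continuousOn, fun s hs => ?_⟩
  exact ((hu.contDiffAt (Ioi_mem_nhds hs)).differentiableAt (by simp)).hasDerivAt

lemma facts3 {E : Type*} [NormedAddCommGroup E] [NormedSpace ℝ E] (u : ℝ → E)
    (hu : ContDiffOn ℝ (⊤ : ℕ∞) u (Ioi 0)) (N : ℝ) (hN : 0 ≤ N)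
    (h : Xnorm 3 u ≤ ENNReal.ofReal N) :
    (IntegrableOn (fun s => s ^ 1 * ‖deriv (deriv u) s‖ ^ 2) (Ioo 0 1) ∧
      ∫ s in Ioo (0:ℝ) 1, s ^ 1 * ‖deriv (deriv u) s‖ ^ 2 ≤ N ^ 2) ∧
    (IntegrableOn (fun s => s ^ 3 * ‖deriv (deriv (deriv u)) s‖ ^ 2) (Ioo 0 1) ∧
      ∫ s in Ioo (0:ℝ) 1, s ^ 3 * ‖deriv (deriv (deriv u)) s‖ ^ 2 ≤ N ^ 2) := by
  have h' : XnormSq 3 u ≤ ENNReal.ofReal (N ^ 2) := by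
    rw [← Xnorm_sq, ENNReal.ofReal_pow hN]; gcongr
  rw [XnormSq_three] at h'
  obtain ⟨s1, -, -⟩ := aux_smooth u hu
  obtain ⟨s2, -, -⟩ := aux_smooth _ s1
  obtain ⟨s3, c2, -⟩ := aux_smooth _ s2
  refine ⟨wL2_int (1/2) 1 (by norm_num) _ c2 _ (by positivity) (le_trans ?_ h'),
    wL2_int (3/2) 3 (by norm_num) _ s3.continuousOn _ (by positivity) (le_trans ?_ h')⟩
  · exact le_self_add.trans le_add_self
  · exact le_add_self.trans le_add_self

lemma facts2 {E : Type*} [NormedAddCommGroup E] [NormedSpace ℝ E] (u : ℝ → E)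
    (hu : ContDiffOn ℝ (⊤ : ℕ∞) u (Ioi 0)) (N : ℝ) (hN : 0 ≤ N)
    (h : Xnorm 2 u ≤ ENNReal.ofReal N) :
    (IntegrableOn (fun s => s ^ 0 * ‖deriv u s‖ ^ 2) (Ioo 0 1) ∧
      ∫ s in Ioo (0:ℝ) 1, s ^ 0 * ‖deriv u s‖ ^ 2 ≤ N ^ 2) ∧
    (IntegrableOn (fun s => s ^ 2 * ‖deriv (deriv u) s‖ ^ 2) (Ioo 0 1) ∧
      ∫ s in Ioo (0:ℝ) 1, s ^ 2 * ‖deriv (deriv u) s‖ ^ 2 ≤ N ^ 2) := by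
  have h' : XnormSq 2 u ≤ ENNReal.ofReal (N ^ 2) := by
    rw [← Xnorm_sq, ENNReal.ofReal_pow hN]; gcongr
  rw [XnormSq_two] at h'
  obtain ⟨s1, -, -⟩ := aux_smooth u hu
  obtain ⟨s2, c1, -⟩ := aux_smooth _ s1
  refine ⟨wL2_int 0 0 (by norm_num) _ c1 _ (by positivity) (le_trans ?_ h'),
    wL2_int 1 2 (by norm_num) _ s2.continuousOn _ (by positivity) (le_trans ?_ h')⟩
  · exact le_add_self.trans le_self_add
  · exact le_add_self

lemma sup2 {E : Type*} [NormedAddCommGroup E] [InnerProductSpace ℝ E] (u : ℝ → E)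
    (hu : ContDiffOn ℝ (⊤ : ℕ∞) u (Ioi 0)) (N : ℝ) (hN : 0 ≤ N)
    (h : Xnorm 2 u ≤ ENNReal.ofReal N) (s : ℝ) (hs : s ∈ Ioc (0:ℝ) 1) :
    s * ‖deriv u s‖ ^ 2 ≤ 4 * N ^ 2 := by
  obtain ⟨⟨i1, b1⟩, ⟨i2, b2⟩⟩ := facts2 u hu N hN h
  obtain ⟨s1, -, -⟩ := aux_smooth u hu
  obtain ⟨s2, c1, d1⟩ := aux_smooth _ s1
  have := aux_sup 0 _ _ d1 s2.continuousOn i1 i2 s hs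
  norm_num at this b1 b2
  linarith

lemma sup3 {E : Type*} [NormedAddCommGroup E] [InnerProductSpace ℝ E] (u : ℝ → E)
    (hu : ContDiffOn ℝ (⊤ : ℕ∞) u (Ioi 0)) (N : ℝ) (hN : 0 ≤ N)
    (h : Xnorm 3 u ≤ ENNReal.ofReal N) (s : ℝ) (hs : s ∈ Ioc (0:ℝ) 1) :
    s ^ 2 * ‖deriv (deriv u) s‖ ^ 2 ≤ 5 * N ^ 2 := by
  obtain ⟨⟨i1, b1⟩, ⟨i2, b2⟩⟩ := facts3 u hu N hN h
  obtain ⟨s1, -, -⟩ := aux_smooth u hu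
  obtain ⟨s2, c1, d1⟩ := aux_smooth _ s1
  obtain ⟨s3, c2, d2⟩ := aux_smooth _ s2
  have := aux_sup 1 _ _ d2 s3.continuousOn i1 i2 s hs
  norm_num at this b1 b2
  linarith

lemma sup1 {E : Type*} [NormedAddCommGroup E] [InnerProductSpace ℝ E] (u : ℝ → E)
    (hu : ContDiffOn ℝ (⊤ : ℕ∞) u (Ioi 0)) (N : ℝ) (hN : 0 ≤ N)
    (h : Xnorm 2 u ≤ ENNReal.ofReal N) : ‖deriv u 1‖ ≤ 2 * N := by
  have := sup2 u hu N hN h 1 (by norm_num)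
  refine abs_le_of_sq_le_sq' ?_ (by positivity) |>.2
  nlinarith

lemma supeps {E : Type*} [NormedAddCommGroup E] [InnerProductSpace ℝ E] [CompleteSpace E] (u : ℝ → E)
    (hu : ContDiffOn ℝ (⊤ : ℕ∞) u (Ioi 0)) (N : ℝ) (hN : 0 ≤ N) (ε : ℝ) (hε : 0 < ε)
    (h : Xnorm 3 u ≤ ENNReal.ofReal N) (s : ℝ) (hs : s ∈ Ioo (0:ℝ) 1) :
    s ^ ε * ‖deriv u s‖ ≤ 2 * N + N ^ 2 + 1 / (2 * ε) := by
  obtain ⟨⟨i1, b1⟩, -⟩ := facts3 u hu N hN h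
  obtain ⟨s1, -, -⟩ := aux_smooth u hu
  obtain ⟨s2, c1, d1⟩ := aux_smooth _ s1
  have hv1 := sup1 u hu N hN ((Xnorm_two_le u).trans h)
  have hse1 : s ^ ε ≤ 1 := Real.rpow_le_one hs.1.le hs.2.le hε.le
  have hse0 : 0 < s ^ ε := Real.rpow_pos_of_pos hs.1 ε
  have ir : IntegrableOn (fun r : ℝ => r ^ (2 * ε - 1)) (Ioo 0 1) := by
    rw [intervalIntegral.integrableOn_Ioo_rpow_iff zero_lt_one]; linarith
  have hir : ∫ r in Ioo (0:ℝ) 1, r ^ (2 * ε - 1) = 1 / (2 * ε) := by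
    rw [← integral_Ioc_eq_integral_Ioo, ← intervalIntegral.integral_of_le zero_le_one,
      integral_rpow (Or.inl (by linarith))]
    have : 2 * ε ≠ 0 := by positivity
    simp [Real.zero_rpow this]
  have := aux_incr (fun r => s ^ ε • deriv u r) (fun r => s ^ ε • deriv (deriv u) r)
    (fun r => r ^ 1 * ‖deriv (deriv u) r‖ ^ 2 + r ^ (2 * ε - 1)) (fun r hr => (d1 r hr).const_smul _)
    (s2.continuousOn.const_smul _) (by exact i1.add ir)
    (fun r hr => by have := hr.1; positivity) s 1 hs.1 hs.2.le le_rfl ?_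
  · rw [integral_add i1 ir, hir, ← smul_sub, norm_smul, Real.norm_of_nonneg hse0.le] at this
    have t : ‖deriv u s‖ ≤ ‖deriv u 1‖ + ‖deriv u 1 - deriv u s‖ := norm_le_norm_add_norm_sub _ _
    have t2 : s ^ ε * ‖deriv u s‖ ≤ s ^ ε * ‖deriv u 1‖ + s ^ ε * ‖deriv u 1 - deriv u s‖ := by
      rw [← mul_add]; gcongr
    have t3 : s ^ ε * ‖deriv u 1‖ ≤ ‖deriv u 1‖ := mul_le_of_le_one_left (norm_nonneg _) hse1
    linarith
  · intro r hr
    have hr0 : 0 < r := hs.1.trans hr.1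
    rw [norm_smul, Real.norm_of_nonneg hse0.le]
    set y := ‖deriv (deriv u) r‖ with hy
    have hy0 : 0 ≤ y := norm_nonneg _
    have e1 : s ^ ε ≤ r ^ ε := Real.rpow_le_rpow hs.1.le hr.1.le hε.le
    have e2 : r ^ (2 * ε - 1) = (r ^ ε) ^ 2 / r := by
      rw [Real.rpow_sub hr0, Real.rpow_one, mul_comm, Real.rpow_mul hr0.le]; norm_num
    have e3 : s ^ ε * y ≤ r ^ ε * y := by gcongr
    refine e3.trans ?_
    rw [e2]
    set z := r ^ ε with hz
    have hz0 : 0 ≤ z := by positivity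
    have : r ^ 1 * y ^ 2 + z ^ 2 / r - z * y = ((r * y - z / 2) ^ 2 + 3 / 4 * z ^ 2) / r := by
      field_simp; ring
    have : 0 ≤ ((r * y - z / 2) ^ 2 + 3 / 4 * z ^ 2) / r := by positivity
    linarith

lemma main_real {E : Type*} [NormedAddCommGroup E] [InnerProductSpace ℝ E]
    (g : E) (x₀ x₁ : ℝ → E) (τ₀ : ℝ → ℝ) (hg : ‖g‖ ≤ 1)
    (h0 : ContDiffOn ℝ (⊤ : ℕ∞) x₀ (Set.Ioi 0)) (h1 : ContDiffOn ℝ (⊤ : ℕ∞) x₁ (Set.Ioi 0))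
    (N P W : ℝ) (hN : 0 ≤ N) (hP : 0 ≤ P) (hW : 0 ≤ W)
    (hXN : Xnorm 3 x₀ ≤ ENNReal.ofReal N) (hXP : Xnorm 2 x₀ ≤ ENNReal.ofReal P)
    (hXW : Xnorm 2 x₁ ≤ ENNReal.ofReal W) (hτ : ContDiff ℝ 2 τ₀)
    (heq : ∀ s ∈ Set.Ioo (0:ℝ) 1,
          -(deriv (deriv τ₀) s) + ‖iteratedDeriv 2 x₀ s‖ ^ 2 * τ₀ s = ‖deriv x₁ s‖ ^ 2)
    (hτ0 : τ₀ 0 = 0) (hτ1 : deriv τ₀ 1 = -⟪g, deriv x₀ 1⟫) :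
    (∀ s ∈ Ioo (0:ℝ) 1, |τ₀ s| ≤ (2 * P + W ^ 2) * s) ∧
    (∀ s ∈ Ioo (0:ℝ) 1, |deriv τ₀ s| ≤ (1 + N ^ 2) * (2 * P + W ^ 2)) := by
  obtain ⟨⟨i1, b1⟩, -⟩ := facts3 x₀ h0 N hN hXN
  obtain ⟨⟨i2, b2⟩, -⟩ := facts2 x₁ h1 W hW hXW
  simp only [pow_one, pow_zero, one_mul] at i1 b1 i2 b2
  have hc := (aux_smooth x₁ h1).1.continuousOn
  have e2 : iteratedDeriv 2 x₀ = deriv (deriv x₀) := by simp [iteratedDeriv_succ]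
  rw [e2] at heq
  have ha : |deriv τ₀ 1| ≤ 2 * P := by
    rw [hτ1, abs_neg]
    refine (abs_real_inner_le_norm _ _).trans ?_
    have := sup1 x₀ h0 P hP hXP
    nlinarith [norm_nonneg g, norm_nonneg (deriv x₀ 1)]
  obtain ⟨r1, r2⟩ := aux_tau (fun s => ‖deriv (deriv x₀) s‖ ^ 2) (fun s => ‖deriv x₁ s‖ ^ 2) τ₀ (2 * P)
    (by fun_prop) (fun s => by positivity) i2 (fun s => by positivity) i1 hτ
    (fun s hs => by have := heq s hs; linarith) hτ0 ha
  constructor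
  · intro s hs
    refine (r1 s ⟨hs.1.le, hs.2.le⟩).trans ?_
    have := hs.1
    gcongr
  · intro s hs
    refine (r2 s hs).trans ?_
    have : 0 ≤ ∫ r in Ioo (0:ℝ) 1, ‖deriv x₁ r‖ ^ 2 := integral_nonneg fun x => by positivity
    gcongr

lemma aux_four (a b c d : ℝ) : (a + b + c + d) ^ 2 ≤ 4 * (a ^ 2 + b ^ 2 + c ^ 2 + d ^ 2) := by
  linarith [sq_nonneg (a - b), sq_nonneg (a - c), sq_nonneg (a - d), sq_nonneg (b - c),
    sq_nonneg (b - d), sq_nonneg (c - d)]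

lemma aux_x2 {E : Type*} [NormedAddCommGroup E] [InnerProductSpace ℝ E]
    (g : E) (x₀ : ℝ → E) (τ₀ : ℝ → ℝ) (x₂ : ℝ → E)
    (h0 : ContDiffOn ℝ (⊤ : ℕ∞) x₀ (Set.Ioi 0)) (hτ : ContDiff ℝ 2 τ₀)
    (hx : ∀ s : ℝ, x₂ s = deriv (fun t => τ₀ t • deriv x₀ t) s + g) (s : ℝ) (hs : 0 < s) :
    x₂ s = τ₀ s • deriv (deriv x₀) s + deriv τ₀ s • deriv x₀ s + g ∧
    deriv x₂ s = (τ₀ s • deriv (deriv (deriv x₀)) s + deriv τ₀ s • deriv (deriv x₀) s) +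
      (deriv τ₀ s • deriv (deriv x₀) s + deriv (deriv τ₀) s • deriv x₀ s) := by
  have h1 : ∀ s, HasDerivAt τ₀ (deriv τ₀ s) s := fun s =>
    (hτ.differentiable (by norm_num) s).hasDerivAt
  have hτ1 : ContDiff ℝ 1 (deriv τ₀) := by
    have : ContDiff ℝ (1 + 1) τ₀ := by simpa [one_add_one_eq_two] using hτ
    exact (contDiff_succ_iff_deriv.1 this).2.2
  have h2 : ∀ s, HasDerivAt (deriv τ₀) (deriv (deriv τ₀) s) s := fun s =>
    (hτ1.differentiable (by norm_num) s).hasDerivAt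
  obtain ⟨s1, -, -⟩ := aux_smooth x₀ h0
  obtain ⟨s2, -, d1⟩ := aux_smooth _ s1
  obtain ⟨-, -, d2⟩ := aux_smooth _ s2
  have e : ∀ s, 0 < s → x₂ s = τ₀ s • deriv (deriv x₀) s + deriv τ₀ s • deriv x₀ s + g := by
    intro s hs
    rw [hx, ((h1 s).fun_smul (d1 s hs)).deriv]
  refine ⟨e s hs, ?_⟩
  have ee : x₂ =ᶠ[nhds s] fun s => τ₀ s • deriv (deriv x₀) s + deriv τ₀ s • deriv x₀ s + g := by
    filter_upwards [Ioi_mem_nhds hs] with r hr using e r hr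
  rw [ee.deriv_eq]
  exact ((((h1 s).fun_smul (d2 s hs)).add ((h2 s).fun_smul (d1 s hs))).add_const g).deriv

set_option maxHeartbeats 1000000 in
lemma main_two {E : Type*} [NormedAddCommGroup E] [InnerProductSpace ℝ E] [CompleteSpace E]
    (ε : ℝ) (hε : 0 < ε) (M : ℝ) (hM : 0 ≤ M) (A B L : ℝ) (hA : A = 2 * M + M ^ 2)
    (hB : B = (1 + M ^ 2) * A) (hL : L = 2 * M + M ^ 2 + 1 / (2 * ε))
    (g : E) (x₀ x₁ : ℝ → E) (τ₀ : ℝ → ℝ) (x₂ : ℝ → E) (hg : ‖g‖ ≤ 1)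
    (h0 : ContDiffOn ℝ (⊤ : ℕ∞) x₀ (Set.Ioi 0)) (h1 : ContDiffOn ℝ (⊤ : ℕ∞) x₁ (Set.Ioi 0))
    (hX0 : Xnorm 3 x₀ ≤ ENNReal.ofReal M)
    (hX1 : Xnorm 2 x₁ ≤ ENNReal.ofReal M) (hτ : ContDiff ℝ 2 τ₀)
    (heq : ∀ s ∈ Set.Ioo (0:ℝ) 1,
          -(deriv (deriv τ₀) s) + ‖iteratedDeriv 2 x₀ s‖ ^ 2 * τ₀ s = ‖deriv x₁ s‖ ^ 2)
    (hτ0 : τ₀ 0 = 0) (hτ1 : deriv τ₀ 1 = -⟪g, deriv x₀ 1⟫)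
    (hx : ∀ s : ℝ, x₂ s = deriv (fun t => τ₀ t • deriv x₀ t) s + g) :
    wL2 0 x₂ ≤ ENNReal.ofReal ((3 * A ^ 2 * M ^ 2 + 3 * B ^ 2 * M ^ 2 + 3) + 1) ∧
    wL2 (1/2 + ε) (deriv x₂) ≤ ENNReal.ofReal (((20 * A ^ 2 * L ^ 2 * M ^ 2 + 16 * B ^ 2) * M ^ 2 +
      16 * L ^ 2 * M ^ 2 * M ^ 2 + 4 * A ^ 2 * M ^ 2) + 1) := by
  have hX02 := (Xnorm_two_le x₀).trans hX0
  obtain ⟨bτ, bτ'⟩ := main_real g x₀ x₁ τ₀ hg h0 h1 M M M hM hM hM hX0 hX02 hX1 hτ heq hτ0 hτ1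
  rw [← hA] at bτ bτ'
  rw [← hB] at bτ'
  have hA0 : 0 ≤ A := by rw [hA]; positivity
  have hB0 : 0 ≤ B := by rw [hB]; positivity
  obtain ⟨⟨i1, b1⟩, ⟨i2, b2⟩⟩ := facts3 x₀ h0 M hM hX0
  obtain ⟨⟨i0, b0⟩, -⟩ := facts2 x₀ h0 M hM hX02
  obtain ⟨⟨iw, bw⟩, -⟩ := facts2 x₁ h1 M hM hX1
  have hx2 := aux_x2 g x₀ τ₀ x₂ h0 hτ hx
  constructor
  · have ic : IntegrableOn (fun _ : ℝ => (3:ℝ)) (Ioo (0:ℝ) 1) := integrableOn_const (by simp)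
    have ia := (i1.const_mul (3 * A ^ 2)).add (i0.const_mul (3 * B ^ 2))
    apply wL2_bound 0 x₂ (fun s => 3 * A ^ 2 * (s ^ 1 * ‖deriv (deriv x₀) s‖ ^ 2) +
      3 * B ^ 2 * (s ^ 0 * ‖deriv x₀ s‖ ^ 2) + 3)
    · exact ia.add ic
    · have e := integral_add ia ic
      have e' := integral_add (i1.const_mul (3 * A ^ 2)) (i0.const_mul (3 * B ^ 2))
      simp only [Pi.add_apply] at e
      rw [e, e', integral_const_mul, integral_const_mul]
      have t1 : 3 * A ^ 2 * (∫ s in Ioo (0:ℝ) 1, s ^ 1 * ‖deriv (deriv x₀) s‖ ^ 2) ≤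
        3 * A ^ 2 * M ^ 2 := by gcongr
      have t2 : 3 * B ^ 2 * (∫ s in Ioo (0:ℝ) 1, s ^ 0 * ‖deriv x₀ s‖ ^ 2) ≤
        3 * B ^ 2 * M ^ 2 := by gcongr
      simp only [integral_const, MeasurableSet.univ, measureReal_restrict_apply, univ_inter,
        Real.volume_real_Ioo, smul_eq_mul]
      norm_num at t1 t2 ⊢
      linarith
    · intro s hs
      have hs0 := hs.1
      rw [(hx2 s hs.1).1]
      simp only [mul_zero, Real.rpow_zero, one_mul, pow_one, pow_zero]
      have n1 : ‖τ₀ s • deriv (deriv x₀) s + deriv τ₀ s • deriv x₀ s + g‖ ≤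
          A * s * ‖deriv (deriv x₀) s‖ + B * ‖deriv x₀ s‖ + 1 := by
        refine (norm_add₃_le).trans ?_
        rw [norm_smul, norm_smul, Real.norm_eq_abs, Real.norm_eq_abs]
        gcongr
        · exact bτ s hs
        · exact bτ' s hs
      set p := ‖deriv (deriv x₀) s‖
      set r := ‖deriv x₀ s‖
      have n2 := pow_le_pow_left₀ (norm_nonneg _) n1 2
      refine n2.trans ?_
      have hss : s ^ 2 ≤ s := by nlinarith [hs.1, hs.2]
      have : A ^ 2 * (s ^ 2 * p ^ 2) ≤ A ^ 2 * (s * p ^ 2) := by gcongr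
      nlinarith [sq_nonneg (A * s * p - B * r), sq_nonneg (A * s * p - 1), sq_nonneg (B * r - 1)]
  · have ia := (i1.const_mul (20 * A ^ 2 * L ^ 2 * M ^ 2 + 16 * B ^ 2)).add
      (iw.const_mul (16 * L ^ 2 * M ^ 2))
    have ic := i2.const_mul (4 * A ^ 2)
    apply wL2_bound _ _ (fun s => (20 * A ^ 2 * L ^ 2 * M ^ 2 + 16 * B ^ 2) *
      (s ^ 1 * ‖deriv (deriv x₀) s‖ ^ 2) + 16 * L ^ 2 * M ^ 2 * (s ^ 0 * ‖deriv x₁ s‖ ^ 2) +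
      4 * A ^ 2 * (s ^ 3 * ‖deriv (deriv (deriv x₀)) s‖ ^ 2))
    · exact ia.add ic
    · have e := integral_add ia ic
      have e' := integral_add (i1.const_mul (20 * A ^ 2 * L ^ 2 * M ^ 2 + 16 * B ^ 2))
        (iw.const_mul (16 * L ^ 2 * M ^ 2))
      simp only [Pi.add_apply] at e
      rw [e, e', integral_const_mul, integral_const_mul, integral_const_mul]
      gcongr
    · intro s hs
      have hs0 := hs.1
      rw [(hx2 s hs.1).2]
      have k1 := sup3 x₀ h0 M hM hX0 s ⟨hs.1, hs.2.le⟩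
      have k2 := sup2 x₁ h1 M hM hX1 s ⟨hs.1, hs.2.le⟩
      have k3 := supeps x₀ h0 M hM ε hε hX0 s hs
      rw [← hL] at k3
      have hee : deriv (deriv τ₀) s = ‖deriv (deriv x₀) s‖ ^ 2 * τ₀ s - ‖deriv x₁ s‖ ^ 2 := by
        have := heq s hs
        have e2 : iteratedDeriv 2 x₀ = deriv (deriv x₀) := by simp [iteratedDeriv_succ]
        rw [e2] at this
        linarith
      have hb2 : |deriv (deriv τ₀) s| ≤ ‖deriv (deriv x₀) s‖ ^ 2 * (A * s) + ‖deriv x₁ s‖ ^ 2 := by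
        rw [hee]
        refine (abs_sub _ _).trans ?_
        rw [abs_mul, abs_of_nonneg (sq_nonneg ‖deriv (deriv x₀) s‖),
          abs_of_nonneg (sq_nonneg ‖deriv x₁ s‖)]
        gcongr
        exact bτ s hs
      have n1 : ‖(τ₀ s • deriv (deriv (deriv x₀)) s + deriv τ₀ s • deriv (deriv x₀) s) +
          (deriv τ₀ s • deriv (deriv x₀) s + deriv (deriv τ₀) s • deriv x₀ s)‖ ≤
          A * s * ‖deriv (deriv (deriv x₀)) s‖ + B * ‖deriv (deriv x₀) s‖ +
          (B * ‖deriv (deriv x₀) s‖ +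
          (‖deriv (deriv x₀) s‖ ^ 2 * (A * s) + ‖deriv x₁ s‖ ^ 2) * ‖deriv x₀ s‖) := by
        refine (norm_add_le _ _).trans ?_
        refine (add_le_add (norm_add_le _ _) (norm_add_le _ _)).trans ?_
        simp only [norm_smul, Real.norm_eq_abs]
        have := bτ s hs
        have := bτ' s hs
        gcongr
      have hse : s ^ (2 * (1 / 2 + ε)) = s * (s ^ ε) ^ 2 := by
        rw [← Real.rpow_natCast, ← Real.rpow_mul hs0.le]
        nth_rewrite 2 [← Real.rpow_one s]
        rw [← Real.rpow_add hs0]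
        congr 1
        push_cast
        ring
      rw [hse]
      have he0 : 0 ≤ s ^ ε := by positivity
      have he1 : s ^ ε ≤ 1 := Real.rpow_le_one hs0.le hs.2.le hε.le
      set e := s ^ ε
      have n2 := pow_le_pow_left₀ (norm_nonneg _) n1 2
      refine (mul_le_mul_of_nonneg_left n2 (by positivity)).trans ?_
      set p := ‖deriv (deriv x₀) s‖
      set r := ‖deriv x₀ s‖
      set d := ‖deriv (deriv (deriv x₀)) s‖
      set w := ‖deriv x₁ s‖
      have hr0 : 0 ≤ r := norm_nonneg _
      have q1 : (A * s * d + B * p + (B * p + (p ^ 2 * (A * s) + w ^ 2) * r)) ^ 2 ≤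
          4 * ((A * s * d) ^ 2 + (2 * B * p) ^ 2 + (p ^ 2 * (A * s) * r) ^ 2 + (w ^ 2 * r) ^ 2) := by
        have := aux_four (A * s * d) (2 * B * p) (p ^ 2 * (A * s) * r) (w ^ 2 * r)
        refine le_trans (le_of_eq ?_) this
        ring
      refine (mul_le_mul_of_nonneg_left q1 (by positivity)).trans ?_
      have he2 : e ^ 2 ≤ 1 := pow_le_one₀ he0 he1
      have hL2 : (e * r) ^ 2 ≤ L ^ 2 := pow_le_pow_left₀ (by positivity) k3 2
      have a1 : e ^ 2 * (A ^ 2 * (s ^ 3 * d ^ 2)) ≤ 1 * (A ^ 2 * (s ^ 3 * d ^ 2)) := by gcongr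
      have a2 : e ^ 2 * (4 * B ^ 2 * (s * p ^ 2)) ≤ 1 * (4 * B ^ 2 * (s * p ^ 2)) := by gcongr
      have a3 : (s ^ 2 * p ^ 2) * (e * r) ^ 2 * (A ^ 2 * (s * p ^ 2)) ≤
        (5 * M ^ 2) * L ^ 2 * (A ^ 2 * (s * p ^ 2)) := by gcongr
      have a4 : (s * w ^ 2) * (e * r) ^ 2 * w ^ 2 ≤ (4 * M ^ 2) * L ^ 2 * w ^ 2 := by gcongr
      calc _ = 4 * (e ^ 2 * (A ^ 2 * (s ^ 3 * d ^ 2)) + e ^ 2 * (4 * B ^ 2 * (s * p ^ 2)) +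
            (s ^ 2 * p ^ 2) * (e * r) ^ 2 * (A ^ 2 * (s * p ^ 2)) +
            (s * w ^ 2) * (e * r) ^ 2 * w ^ 2) := by ring
        _ ≤ 4 * (1 * (A ^ 2 * (s ^ 3 * d ^ 2)) + 1 * (4 * B ^ 2 * (s * p ^ 2)) +
            (5 * M ^ 2) * L ^ 2 * (A ^ 2 * (s * p ^ 2)) + (4 * M ^ 2) * L ^ 2 * w ^ 2) := by
          linarith
        _ = _ := by ring

/-- bounds on the initial tension `τ₀` and on `x₂ = (τ₀ x₀')' + g`
(so that `x₂ ∈ X¹_ε` for every `ε > 0`).  Here `⟪·,·⟫` is the real inner product on `ℝ³`. -/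
theorem stmt15 :
    (∃ C : ℝ≥0∞ → ℝ≥0∞, (∀ t, 0 < C t) ∧ (∀ t, t ≠ ⊤ → C t ≠ ⊤) ∧ Monotone C ∧
      ∀ (g : EuclideanSpace ℝ (Fin 3)) (x₀ x₁ : ℝ → EuclideanSpace ℝ (Fin 3)) (τ₀ : ℝ → ℝ),
        ‖g‖ ≤ 1 →
        ContDiffOn ℝ (⊤ : ℕ∞) x₀ (Set.Ioi 0) → ContDiffOn ℝ (⊤ : ℕ∞) x₁ (Set.Ioi 0) →
        Xnorm 3 x₀ ≠ ⊤ → Xnorm 2 x₁ ≠ ⊤ →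
        ContDiff ℝ 2 τ₀ →
        (∀ s ∈ Set.Ioo (0:ℝ) 1,
          -(deriv (deriv τ₀) s) + ‖iteratedDeriv 2 x₀ s‖ ^ 2 * τ₀ s = ‖deriv x₁ s‖ ^ 2) →
        τ₀ 0 = 0 → deriv τ₀ 1 = -⟪g, deriv x₀ 1⟫ →
        wLinf 0 (deriv τ₀) ≤ C (Xnorm 3 x₀) * (Xnorm 2 x₀ + Xnorm 2 x₁ ^ 2)) ∧
    (∀ ε : ℝ, 0 < ε → ∀ M : ℝ, 0 < M → ∃ C' : ℝ, 0 < C' ∧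
      ∀ (g : EuclideanSpace ℝ (Fin 3)) (x₀ x₁ : ℝ → EuclideanSpace ℝ (Fin 3)) (τ₀ : ℝ → ℝ)
        (x₂ : ℝ → EuclideanSpace ℝ (Fin 3)),
        ‖g‖ ≤ 1 →
        ContDiffOn ℝ (⊤ : ℕ∞) x₀ (Set.Ioi 0) → ContDiffOn ℝ (⊤ : ℕ∞) x₁ (Set.Ioi 0) →
        Xnorm 3 x₀ ≤ ENNReal.ofReal M → Xnorm 2 x₁ ≤ ENNReal.ofReal M →
        ContDiff ℝ 2 τ₀ →
        (∀ s ∈ Set.Ioo (0:ℝ) 1,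
          -(deriv (deriv τ₀) s) + ‖iteratedDeriv 2 x₀ s‖ ^ 2 * τ₀ s = ‖deriv x₁ s‖ ^ 2) →
        τ₀ 0 = 0 → deriv τ₀ 1 = -⟪g, deriv x₀ 1⟫ →
        (∀ s : ℝ, x₂ s = deriv (fun t => τ₀ t • deriv x₀ t) s + g) →
        wL2 0 x₂ + wL2 (1/2 + ε) (deriv x₂) ≤ ENNReal.ofReal C') := by
  constructor
  · refine ⟨fun t => 2 * (1 + t ^ 2), fun t => ?_, fun t ht => ?_, fun a b hab => ?_, ?_⟩
    · positivity
    · exact ENNReal.mul_ne_top (by simp) (ENNReal.add_ne_top.2 ⟨by simp, ENNReal.pow_ne_top ht⟩)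
    · simp only
      gcongr
    · intro g x₀ x₁ τ₀ hg h0 h1 hX0 hX1 hτ heq hτ0 hτ1
      have hX2 : Xnorm 2 x₀ ≠ ⊤ := ne_top_of_le_ne_top hX0 (Xnorm_two_le x₀)
      obtain ⟨-, b⟩ := main_real g x₀ x₁ τ₀ hg h0 h1 (Xnorm 3 x₀).toReal (Xnorm 2 x₀).toReal
        (Xnorm 2 x₁).toReal ENNReal.toReal_nonneg ENNReal.toReal_nonneg ENNReal.toReal_nonneg
        (ENNReal.ofReal_toReal hX0).ge (ENNReal.ofReal_toReal hX2).ge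
        (ENNReal.ofReal_toReal hX1).ge hτ heq hτ0 hτ1
      unfold wLinf
      apply iSup_le
      intro s
      have hfin : 2 * (1 + Xnorm 3 x₀ ^ 2) * (Xnorm 2 x₀ + Xnorm 2 x₁ ^ 2) ≠ ⊤ := by
        refine ENNReal.mul_ne_top (ENNReal.mul_ne_top (by simp) (ENNReal.add_ne_top.2
          ⟨by simp, ENNReal.pow_ne_top hX0⟩)) (ENNReal.add_ne_top.2 ⟨hX2, ENNReal.pow_ne_top hX1⟩)
      rw [ENNReal.ofReal_le_iff_le_toReal hfin, ENNReal.toReal_mul, ENNReal.toReal_mul,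
        ENNReal.toReal_add (by simp) (ENNReal.pow_ne_top hX0),
        ENNReal.toReal_add hX2 (ENNReal.pow_ne_top hX1), ENNReal.toReal_pow, ENNReal.toReal_pow,
        Real.rpow_zero, one_mul, Real.norm_eq_abs]
      refine (b s s.2).trans ?_
      simp only [ENNReal.toReal_ofNat, ENNReal.toReal_one]
      have hW : 0 ≤ (1 + (Xnorm 3 x₀).toReal ^ 2) * (Xnorm 2 x₁).toReal ^ 2 := by positivity
      linarith
  · intro ε hε M hM
    refine ⟨((3 * (2 * M + M ^ 2) ^ 2 * M ^ 2 +
      3 * ((1 + M ^ 2) * (2 * M + M ^ 2)) ^ 2 * M ^ 2 + 3) + 1) +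
      (((20 * (2 * M + M ^ 2) ^ 2 * (2 * M + M ^ 2 + 1 / (2 * ε)) ^ 2 * M ^ 2 +
      16 * ((1 + M ^ 2) * (2 * M + M ^ 2)) ^ 2) * M ^ 2 +
      16 * (2 * M + M ^ 2 + 1 / (2 * ε)) ^ 2 * M ^ 2 * M ^ 2 +
      4 * (2 * M + M ^ 2) ^ 2 * M ^ 2) + 1), by positivity, ?_⟩
    intro g x₀ x₁ τ₀ x₂ hg h0 h1 hX0 hX1 hτ heq hτ0 hτ1 hx
    obtain ⟨r1, r2⟩ := main_two ε hε M hM.le _ _ _ rfl rfl rfl g x₀ x₁ τ₀ x₂ hg h0 h1 hX0 hX1 hτ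
      heq hτ0 hτ1 hx
    rw [ENNReal.ofReal_add (by positivity) (by positivity)]
    exact add_le_add r1 r2
end
end

section
/- Define the averaging operator (Mu)(s) = (1/s) ∫₀^s u(σ) dσ for functions u on (0,1). Let j be a nonnegative integer, p ∈ [1, ∞], and β < j + 1 - 1/p. Then for every sufficiently smooth u on (0,1) with ‖s^β ∂_s^j u‖_{L^p(0,1)} finite, one has ‖s^β ∂_s^j (Mu)‖_{L^p(0,1)} ≤ (j + 1 - β - 1/p)^{-1} ‖s^β ∂_s^j u‖_{L^p(0,1)}. In particular, ‖Mu‖_{X^m} ≤ 2 ‖u‖_{X^m} for every nonnegative integer m. -/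
open MeasureTheory ENNReal RealInnerProductSpace

noncomputable section

/-- The averaging operator `(Mu)(s) = (1/s) ∫₀^s u(σ) dσ`. -/
def avgOp (u : ℝ → ℝ) : ℝ → ℝ := fun s => s⁻¹ * ∫ σ in (0:ℝ)..s, u σ

lemma aux_tri (c : ℝ) (A B : ℝ → ℝ≥0∞) (hA : Measurable A) (hB : Measurable B) :
    ∫⁻ s in Set.Ioo 0 c, A s * ∫⁻ t in Set.Ioo 0 s, B t =
      ∫⁻ t in Set.Ioo 0 c, B t * ∫⁻ s in Set.Ioo t c, A s := by
  set K : ℝ → ℝ → ℝ≥0∞ := fun s t => if 0 < t ∧ t < s ∧ s < c then A s * B t else 0 with hK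
  have h1 : ∫⁻ s in Set.Ioo 0 c, A s * ∫⁻ t in Set.Ioo 0 s, B t = ∫⁻ s, ∫⁻ t, K s t := by
    rw [← lintegral_indicator measurableSet_Ioo]
    refine lintegral_congr fun s => ?_
    by_cases hs : s ∈ Set.Ioo 0 c
    · rw [Set.indicator_of_mem hs, ← lintegral_const_mul _ hB,
        ← lintegral_indicator measurableSet_Ioo]
      refine lintegral_congr fun t => ?_
      simp only [hK, Set.indicator_apply, Set.mem_Ioo]
      have := hs.2
      congr 1
      simp [this]
    · rw [Set.indicator_of_notMem hs]
      symm
      rw [lintegral_eq_zero_iff']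
      · filter_upwards with t
        simp only [hK, Pi.zero_apply]
        rw [if_neg]
        rintro ⟨h, h', h''⟩
        exact hs ⟨h.trans h', h''⟩
      · refine Measurable.aemeasurable ?_
        refine Measurable.ite ?_ (hB.const_mul _) measurable_const
        exact (measurableSet_lt measurable_const measurable_id).inter
          ((measurableSet_lt measurable_id measurable_const).inter (MeasurableSet.const _))
  have h2 : ∫⁻ t in Set.Ioo 0 c, B t * ∫⁻ s in Set.Ioo t c, A s = ∫⁻ t, ∫⁻ s, K s t := by
    rw [← lintegral_indicator measurableSet_Ioo]
    refine lintegral_congr fun t => ?_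
    by_cases hs : t ∈ Set.Ioo 0 c
    · rw [Set.indicator_of_mem hs, ← lintegral_const_mul _ hA,
        ← lintegral_indicator measurableSet_Ioo]
      refine lintegral_congr fun s => ?_
      simp only [hK, Set.indicator_apply, Set.mem_Ioo]
      have := hs.1
      simp [this, mul_comm]
    · rw [Set.indicator_of_notMem hs]
      symm
      rw [lintegral_eq_zero_iff']
      · filter_upwards with s
        simp only [hK, Pi.zero_apply]
        rw [if_neg]
        rintro ⟨h, h', h''⟩
        exact hs ⟨h, h'.trans h''⟩
      · refine Measurable.aemeasurable ?_
        refine Measurable.ite ?_ (hA.mul_const _) measurable_const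
        exact (MeasurableSet.const _).inter
          ((measurableSet_lt measurable_const measurable_id).inter
            (measurableSet_lt measurable_id measurable_const))
  rw [h1, h2]
  apply lintegral_lintegral_swap
  refine Measurable.aemeasurable ?_
  refine Measurable.ite ?_ ((hA.comp measurable_fst).mul (hB.comp measurable_snd)) measurable_const
  exact (measurableSet_lt measurable_const measurable_snd).inter
          ((measurableSet_lt measurable_snd measurable_fst).inter
            (measurableSet_lt measurable_fst measurable_const))

lemma aux_pow (κ s : ℝ) (hκ : 0 < κ) (hs : 0 < s) :
    ∫⁻ σ in Set.Ioo 0 s, ENNReal.ofReal (σ ^ (κ - 1)) = ENNReal.ofReal (s ^ κ / κ) := by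
  rw [← ofReal_integral_eq_lintegral_ofReal]
  · rw [← integral_Ioc_eq_integral_Ioo, ← intervalIntegral.integral_of_le hs.le,
      integral_rpow (Or.inl (by linarith))]
    simp [Real.zero_rpow hκ.ne']
  · exact (intervalIntegral.integrableOn_Ioo_rpow_iff hs).2 (by linarith)
  · filter_upwards [ae_restrict_mem measurableSet_Ioo] with x hx
    exact Real.rpow_nonneg hx.1.le _

lemma aux_tail (κ t : ℝ) (hκ : 0 < κ) (ht : 0 < t) (ht1 : t < 1) :
    ∫⁻ s in Set.Ioo t 1, ENNReal.ofReal (s ^ (-κ - 1)) ≤ ENNReal.ofReal (t ^ (-κ) / κ) := by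
  have h0 : (0:ℝ) ∉ Set.uIcc t 1 := by
    rw [Set.uIcc_of_le ht1.le]; rintro ⟨h, _⟩; linarith
  rw [← ofReal_integral_eq_lintegral_ofReal]
  · rw [← integral_Ioc_eq_integral_Ioo, ← intervalIntegral.integral_of_le ht1.le,
      integral_rpow (Or.inr ⟨by linarith, h0⟩)]
    apply ENNReal.ofReal_le_ofReal
    rw [show -κ - 1 + 1 = -κ by ring, Real.one_rpow, div_neg, ← neg_div]
    gcongr
    linarith
  · refine IntegrableOn.mono_set (t := Set.Ioc t 1) ?_ Set.Ioo_subset_Ioc_self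
    rw [← intervalIntegrable_iff_integrableOn_Ioc_of_le ht1.le]
    exact intervalIntegral.intervalIntegrable_rpow (Or.inr h0)
  · filter_upwards [ae_restrict_mem measurableSet_Ioo] with x hx
    exact Real.rpow_nonneg (ht.trans hx.1).le _

/-- Jensen-type inequality. -/
lemma aux_jensen (κ q s : ℝ) (hκ : 0 < κ) (hq : 1 ≤ q) (hs : 0 < s) (F : ℝ → ℝ≥0∞)
    (hF : Measurable F) :
    (∫⁻ σ in Set.Ioo 0 s, ENNReal.ofReal (σ ^ (κ - 1)) * F σ) ^ q ≤
      (∫⁻ σ in Set.Ioo 0 s, ENNReal.ofReal (σ ^ (κ - 1)) * F σ ^ q) *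
        ENNReal.ofReal (s ^ κ / κ) ^ (q - 1) := by
  have hq0 : 0 < q := by linarith
  have hm : Measurable fun σ : ℝ => ENNReal.ofReal (σ ^ (κ - 1)) := by fun_prop
  set μ := (volume.restrict (Set.Ioo 0 s)).withDensity fun σ : ℝ => ENNReal.ofReal (σ ^ (κ - 1))
    with hμ
  have h := eLpNorm'_le_eLpNorm'_mul_rpow_measure_univ (μ := μ) (f := F) one_pos hq
    hF.aestronglyMeasurable
  have hu : μ Set.univ = ENNReal.ofReal (s ^ κ / κ) := by
    rw [hμ, withDensity_apply _ MeasurableSet.univ, Measure.restrict_univ, aux_pow κ s hκ hs]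
  rw [hu] at h
  simp only [eLpNorm', enorm_eq_self, ENNReal.rpow_one, div_one] at h
  rw [hμ, lintegral_withDensity_eq_lintegral_mul _ hm hF,
    lintegral_withDensity_eq_lintegral_mul _ hm (hF.pow_const q)] at h
  have h' := ENNReal.rpow_le_rpow h hq0.le
  rw [ENNReal.mul_rpow_of_nonneg _ _ hq0.le, ← ENNReal.rpow_mul, ← ENNReal.rpow_mul,
    one_div_mul_cancel hq0.ne', ENNReal.rpow_one, sub_mul, one_div_mul_cancel hq0.ne', one_mul] at h'
  exact h'

lemma aux_hardy (κ q : ℝ) (hκ : 0 < κ) (hq : 1 ≤ q) (G : ℝ → ℝ≥0∞) (hG : Measurable G) :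
    ∫⁻ s in Set.Ioo (0:ℝ) 1, (ENNReal.ofReal (s ^ (-κ - q⁻¹)) *
      ∫⁻ σ in Set.Ioo 0 s, ENNReal.ofReal (σ ^ (κ - 1)) * (ENNReal.ofReal (σ ^ q⁻¹) * G σ)) ^ q ≤
    ENNReal.ofReal κ⁻¹ ^ q * ∫⁻ s in Set.Ioo (0:ℝ) 1, G s ^ q := by
  have hq0 : 0 < q := by linarith
  have hF : Measurable fun σ : ℝ => ENNReal.ofReal (σ ^ q⁻¹) * G σ := by fun_prop
  calc _ ≤ ∫⁻ s in Set.Ioo (0:ℝ) 1, ENNReal.ofReal κ⁻¹ ^ (q - 1) * (ENNReal.ofReal (s ^ (-κ - 1)) *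
        ∫⁻ σ in Set.Ioo 0 s, ENNReal.ofReal (σ ^ (κ - 1)) * (ENNReal.ofReal (σ ^ q⁻¹) * G σ) ^ q) := by
        refine setLIntegral_mono' measurableSet_Ioo fun s hs => ?_
        have hs0 := hs.1
        rw [ENNReal.mul_rpow_of_nonneg _ _ hq0.le]
        refine (mul_le_mul_right (aux_jensen κ q s hκ hq hs.1 _ hF) _).trans (le_of_eq ?_)
        have : ENNReal.ofReal (s ^ (-κ - q⁻¹)) ^ q * ENNReal.ofReal (s ^ κ / κ) ^ (q - 1) =
            ENNReal.ofReal κ⁻¹ ^ (q - 1) * ENNReal.ofReal (s ^ (-κ - 1)) := by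
          have e1 : (0:ℝ) ≤ κ⁻¹ := by positivity
          rw [ENNReal.ofReal_rpow_of_nonneg (by positivity) (by linarith),
            ENNReal.ofReal_rpow_of_nonneg (by positivity) (by linarith),
            ENNReal.ofReal_rpow_of_nonneg (by positivity) (by linarith),
            ← ENNReal.ofReal_mul (by positivity), ← ENNReal.ofReal_mul (by positivity)]
          congr 1
          rw [div_eq_mul_inv, Real.mul_rpow (by positivity) (by positivity), ← Real.rpow_mul hs0.le,
            ← Real.rpow_mul hs0.le, ← mul_assoc, ← Real.rpow_add hs0, mul_comm]
          congr 2
          field_simp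
          ring
        rw [← mul_assoc (ENNReal.ofReal κ⁻¹ ^ (q - 1)), ← this]
        ring
    _ = ENNReal.ofReal κ⁻¹ ^ (q - 1) * ∫⁻ t in Set.Ioo (0:ℝ) 1,
          (ENNReal.ofReal (t ^ (κ - 1)) * (ENNReal.ofReal (t ^ q⁻¹) * G t) ^ q) *
          ∫⁻ s in Set.Ioo t 1, ENNReal.ofReal (s ^ (-κ - 1)) := by
        rw [lintegral_const_mul' _ _ (ENNReal.rpow_ne_top_of_nonneg (by linarith) (by simp)),
          aux_tri]
        · fun_prop
        · fun_prop
    _ ≤ ENNReal.ofReal κ⁻¹ ^ (q - 1) * ∫⁻ t in Set.Ioo (0:ℝ) 1, ENNReal.ofReal κ⁻¹ * G t ^ q := by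
        refine mul_le_mul_right ?_ _
        refine setLIntegral_mono' measurableSet_Ioo fun t ht => ?_
        have ht0 := ht.1
        refine (mul_le_mul_right (aux_tail κ t hκ ht.1 ht.2) _).trans (le_of_eq ?_)
        rw [ENNReal.mul_rpow_of_nonneg _ _ hq0.le,
            ENNReal.ofReal_rpow_of_nonneg (by positivity) (by linarith), ← Real.rpow_mul ht0.le,
            inv_mul_cancel₀ hq0.ne', Real.rpow_one]
        rw [← mul_assoc, mul_right_comm, ← ENNReal.ofReal_mul (by positivity),
          ← ENNReal.ofReal_mul (by positivity)]
        congr 2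
        rw [Real.rpow_sub ht0, Real.rpow_neg ht0.le, Real.rpow_one]
        have := (Real.rpow_pos_of_pos ht0 κ).ne'
        field_simp
    _ = _ := by
        rw [lintegral_const_mul' _ _ (by simp), ← mul_assoc]
        congr 1
        have e : ENNReal.ofReal κ⁻¹ ≠ 0 := by simpa using hκ
        nth_rw 2 [← ENNReal.rpow_one (ENNReal.ofReal κ⁻¹)]
        rw [← ENNReal.rpow_add _ _ e (by simp)]
        simp

lemma aux_meas (f : ℝ → ℝ) (hf : ContinuousOn f (Set.Ioo 0 1)) :
    Measurable (Set.indicator (Set.Ioo (0:ℝ) 1) f) := by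
  classical
  rw [← Set.piecewise_eq_indicator]
  exact hf.measurable_piecewise continuousOn_const measurableSet_Ioo

lemma aux_ftc (h h' : ℝ → ℝ) (hd : ∀ x ∈ Set.Ioo (0:ℝ) 1, HasDerivAt h (h' x) x)
    (s : ℝ) (hs : s ∈ Set.Ioo (0:ℝ) 1) (hi : IntervalIntegrable h' volume 0 s)
    (hj : IntervalIntegrable (fun x => x⁻¹ * h x) volume 0 s) :
    ∫ x in (0:ℝ)..s, h' x = h s := by
  set L := h s - ∫ x in (0:ℝ)..s, h' x with hL
  have hs0 := hs.1
  have hs1 := hs.2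
  have hform : ∀ x ∈ Set.Ioo 0 s, h x = L + ∫ y in (0:ℝ)..x, h' y := by
    intro x hx
    have hx0 := hx.1
    have hxs := hx.2
    have i1 : IntervalIntegrable h' volume 0 x := hi.mono_set (by
      rw [Set.uIcc_of_le hx0.le, Set.uIcc_of_le hs0.le]
      exact Set.Icc_subset_Icc_right hxs.le)
    have i2 : IntervalIntegrable h' volume x s := hi.mono_set (by
      rw [Set.uIcc_of_le hxs.le, Set.uIcc_of_le hs0.le]
      exact Set.Icc_subset_Icc_left hx0.le)
    have e := intervalIntegral.integral_eq_sub_of_hasDerivAt (a := x) (b := s) (f := h) (f' := h')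
      (by
        intro y hy
        rw [Set.uIcc_of_le hxs.le] at hy
        exact hd y ⟨hx0.trans_le hy.1, hy.2.trans_lt hs1⟩) i2
    have e2 := intervalIntegral.integral_add_adjacent_intervals i1 i2
    linarith
  have hlim : Filter.Tendsto h (nhdsWithin 0 (Set.Ioi 0)) (nhds L) := by
    have hc := intervalIntegral.continuousOn_primitive_interval' hi Set.left_mem_uIcc
    have hc0 := (hc 0 Set.left_mem_uIcc).tendsto
    rw [intervalIntegral.integral_same, Set.uIcc_of_le hs0.le] at hc0
    have hc1 := hc0.mono_left (nhdsWithin_mono 0 (Set.Ioo_subset_Icc_self))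
    rw [nhdsWithin_Ioo_eq_nhdsGT hs0] at hc1
    have hc2 := hc1.const_add L
    rw [add_zero] at hc2
    refine hc2.congr' ?_
    filter_upwards [Ioo_mem_nhdsGT hs0] with x hx
    exact (hform x hx).symm
  by_contra hne
  have hL0 : L ≠ 0 := fun h0 => hne (by linarith)
  have hLp : 0 < |L| := abs_pos.2 hL0
  have hev : ∀ᶠ x in nhdsWithin 0 (Set.Ioi 0), |L| / 2 < |h x| :=
    (hlim.abs).eventually_const_lt (by linarith)
  obtain ⟨δ, hδ, hsub⟩ := mem_nhdsGT_iff_exists_Ioo_subset.1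
    (Filter.inter_mem hev (Ioo_mem_nhdsGT hs0))
  have hδ0 : 0 < δ := hδ
  have hδs : Set.Ioo 0 δ ⊆ Set.Ioo 0 s := fun x hx => (hsub hx).2
  have hj' := (intervalIntegrable_iff_integrableOn_Ioo_of_le hs0.le).1 hj
  have hj2 : IntegrableOn (fun x => (2 / |L|) * (x⁻¹ * h x)) (Set.Ioo 0 δ) :=
    (hj'.mono_set hδs).const_mul _
  have hbad : IntegrableOn (fun x : ℝ => x ^ (-1 : ℝ)) (Set.Ioo 0 δ) := by
    refine Integrable.mono hj2 (by fun_prop) ?_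
    filter_upwards [ae_restrict_mem measurableSet_Ioo] with x hx
    have hx0 := hx.1
    have hb : |L| / 2 < |h x| := (hsub hx).1
    rw [Real.rpow_neg_one, Real.norm_eq_abs, Real.norm_eq_abs, abs_mul, abs_mul,
      abs_of_pos (by positivity : 0 < x⁻¹), abs_of_pos (by positivity : 0 < 2 / |L|)]
    calc x⁻¹ = (2 / |L|) * (x⁻¹ * (|L| / 2)) := by field_simp
      _ ≤ _ := by gcongr
  have := (intervalIntegral.integrableOn_Ioo_rpow_iff hδ0).1 hbad
  linarith

lemma aux_int (v v' : ℝ → ℝ) (hd : ∀ x ∈ Set.Ioo (0:ℝ) 1, HasDerivAt v (v' x) x)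
    (hc : ContinuousOn v' (Set.Ioo 0 1)) (n : ℕ) (c : ℝ) (hcc : c ∈ Set.Ioo (0:ℝ) 1)
    (hi : IntervalIntegrable (fun x => x ^ (n + 1) * v' x) volume 0 c) :
    IntervalIntegrable (fun x => x ^ n * v x) volume 0 c := by
  have hc0 := hcc.1
  have hc1 := hcc.2
  have hsub : Set.Ioo 0 c ⊆ Set.Ioo 0 1 := Set.Ioo_subset_Ioo_right hc1.le
  rw [intervalIntegrable_iff_integrableOn_Ioo_of_le hc0.le] at hi ⊢
  set w := Set.indicator (Set.Ioo (0:ℝ) 1) v' with hw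
  have hwm : Measurable w := aux_meas v' hc
  have hvc : ContinuousOn v (Set.Ioo 0 1) := fun x hx => (hd x hx).continuousAt.continuousWithinAt
  refine ⟨(((continuous_pow n).continuousOn.mul hvc).mono hsub).aestronglyMeasurable
    measurableSet_Ioo, ?_⟩
  have hpt : ∀ x ∈ Set.Ioo 0 c, ‖v x‖ₑ ≤ ‖v c‖ₑ + ∫⁻ t in Set.Ioo x c, ‖w t‖ₑ := by
    intro x hx
    have hxc := hx.2
    have hIcc : Set.Icc x c ⊆ Set.Ioo 0 1 := fun y hy => ⟨hx.1.trans_le hy.1, hy.2.trans_lt hc1⟩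
    have e := intervalIntegral.integral_eq_sub_of_hasDerivAt (a := x) (b := c) (f := v) (f' := v')
      (by
        intro y hy
        rw [Set.uIcc_of_le hxc.le] at hy
        exact hd y (hIcc hy))
      (ContinuousOn.intervalIntegrable (by rw [Set.uIcc_of_le hxc.le]; exact hc.mono hIcc))
    have e2 : v x = v c - ∫ y in x..c, v' y := by linarith
    rw [e2, intervalIntegral.integral_of_le hxc.le, integral_Ioc_eq_integral_Ioo]
    refine (enorm_sub_le).trans ?_
    gcongr
    refine (enorm_integral_le_lintegral_enorm _).trans (le_of_eq ?_)
    refine setLIntegral_congr_fun measurableSet_Ioo fun y hy => ?_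
    rw [hw, Set.indicator_of_mem (hIcc (Set.Ioo_subset_Icc_self hy))]
  have hle : ∫⁻ x in Set.Ioo 0 c, ‖x ^ n * v x‖ₑ ≤
      ∫⁻ x in Set.Ioo 0 c, (‖v c‖ₑ + ‖x ^ n‖ₑ * ∫⁻ t in Set.Ioo x c, ‖w t‖ₑ) := by
    refine setLIntegral_mono' measurableSet_Ioo fun x hx => ?_
    rw [enorm_mul]
    have h1 : ‖x ^ n‖ₑ ≤ 1 := by
      rw [Real.enorm_eq_ofReal (by have := hx.1; positivity)]
      exact ENNReal.ofReal_le_one.2 (pow_le_one₀ hx.1.le (hx.2.trans hc1).le)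
    calc _ ≤ ‖x ^ n‖ₑ * (‖v c‖ₑ + ∫⁻ t in Set.Ioo x c, ‖w t‖ₑ) := by
          gcongr; exact hpt x hx
      _ ≤ _ := by
        rw [mul_add]
        gcongr
        exact mul_le_of_le_one_left' h1
  refine lt_of_le_of_lt hle ?_
  rw [lintegral_add_left measurable_const]
  refine ENNReal.add_lt_top.2 ⟨by simp [ENNReal.mul_lt_top], ?_⟩
  rw [← aux_tri c (fun t => ‖w t‖ₑ) (fun x => ‖x ^ n‖ₑ) (by fun_prop) (by fun_prop)]
  refine lt_of_le_of_lt ?_ hi.2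
  refine setLIntegral_mono' measurableSet_Ioo fun t ht => ?_
  have ht0 := ht.1
  have : ∫⁻ x in Set.Ioo 0 t, ‖x ^ n‖ₑ ≤ ‖t ^ (n + 1)‖ₑ := by
    calc _ ≤ ∫⁻ x in Set.Ioo 0 t, ‖t ^ n‖ₑ := by
          refine setLIntegral_mono' measurableSet_Ioo fun x hx => ?_
          have hx0 := hx.1
          rw [Real.enorm_eq_ofReal (by positivity), Real.enorm_eq_ofReal (by positivity)]
          apply ENNReal.ofReal_le_ofReal
          have := hx.2
          gcongr
      _ = _ := by
          rw [setLIntegral_const, Real.volume_Ioo, sub_zero, pow_succ, enorm_mul,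
            Real.enorm_eq_ofReal ht0.le]
  rw [enorm_mul, mul_comm, hw, Set.indicator_of_mem (hsub ht)]
  gcongr

lemma aux_iter (u : ℝ → ℝ) (hu : ContDiffOn ℝ (⊤ : ℕ∞) u (Set.Ioo 0 1)) (n : ℕ) :
    ContinuousOn (iteratedDeriv n u) (Set.Ioo 0 1) ∧
    ∀ x ∈ Set.Ioo (0:ℝ) 1, HasDerivAt (iteratedDeriv n u) (iteratedDeriv (n + 1) u x) x := by
  have heq : Set.EqOn (iteratedDerivWithin n u (Set.Ioo 0 1)) (iteratedDeriv n u) (Set.Ioo 0 1) :=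
    iteratedDerivWithin_of_isOpen isOpen_Ioo
  have hdiff : DifferentiableOn ℝ (iteratedDeriv n u) (Set.Ioo 0 1) :=
    (hu.differentiableOn_iteratedDerivWithin (m := n) (by exact_mod_cast ENat.natCast_lt_top n)
      isOpen_Ioo.uniqueDiffOn).congr fun x hx => (heq hx).symm
  refine ⟨hdiff.continuousOn, fun x hx => ?_⟩
  rw [iteratedDeriv_succ]
  exact (hdiff.differentiableAt (isOpen_Ioo.mem_nhds hx)).hasDerivAt

lemma aux_formula (u : ℝ → ℝ) (hu : ContDiffOn ℝ (⊤ : ℕ∞) u (Set.Ioo 0 1)) (n : ℕ) :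
    (∀ c ∈ Set.Ioo (0:ℝ) 1,
      IntervalIntegrable (fun x => x ^ n * iteratedDeriv n u x) volume 0 c) →
    ∀ s ∈ Set.Ioo (0:ℝ) 1, iteratedDeriv n (avgOp u) s =
      (s ^ (n + 1))⁻¹ * ∫ x in (0:ℝ)..s, x ^ n * iteratedDeriv n u x := by
  induction n with
  | zero =>
    intro _ s hs
    simp [avgOp]
  | succ n ih =>
    intro hi s hs
    obtain ⟨hvc, hvd⟩ := aux_iter u hu n
    obtain ⟨hvc', -⟩ := aux_iter u hu (n + 1)
    have hi' : ∀ c ∈ Set.Ioo (0:ℝ) 1,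
        IntervalIntegrable (fun x => x ^ n * iteratedDeriv n u x) volume 0 c :=
      fun c hc => aux_int _ _ hvd hvc' n c hc (hi c hc)
    have hform := ih hi'
    have hs0 := hs.1
    have hsn := hs0.ne'
    have hnh := isOpen_Ioo.mem_nhds hs
    have hcont : ContinuousOn (fun x => x ^ n * iteratedDeriv n u x) (Set.Ioo 0 1) :=
      (continuous_pow n).continuousOn.mul hvc
    have hD1 := intervalIntegral.integral_hasDerivAt_right (hi' s hs)
      (hcont.stronglyMeasurableAtFilter isOpen_Ioo s hs) (hcont.continuousAt hnh)
    have hD2 : HasDerivAt (fun x : ℝ => (x ^ (n + 1))⁻¹) _ s :=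
      (hasDerivAt_pow (n + 1) s).fun_inv (pow_ne_zero _ hsn)
    have hD := hD2.mul hD1
    have hev : iteratedDeriv n (avgOp u) =ᶠ[nhds s]
        ((fun x : ℝ => (x ^ (n + 1))⁻¹) * fun y => ∫ x in (0:ℝ)..y, x ^ n * iteratedDeriv n u x) := by
      filter_upwards [hnh] with x hx
      exact hform x hx
    rw [iteratedDeriv_succ, hev.deriv_eq, hD.deriv]
    have hF := aux_ftc (fun x => x ^ (n + 1) * iteratedDeriv n u x)
      (fun x => ((n + 1 : ℕ) : ℝ) * (x ^ n * iteratedDeriv n u x)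
        + x ^ (n + 1) * iteratedDeriv (n + 1) u x)
      (by
        intro x hx
        have := (hasDerivAt_pow (n + 1) x).fun_mul (hvd x hx)
        refine this.congr_deriv ?_
        rw [Nat.add_sub_cancel]
        ring) s hs (((hi' s hs).const_mul _).add (hi s hs))
      (by
        refine (hi' s hs).congr ?_
        intro x hx
        rw [Set.uIoc_of_le hs0.le] at hx
        have := hx.1.ne'
        simp only
        field_simp
        ring)
    rw [intervalIntegral.integral_add ((hi' s hs).const_mul _) (hi s hs),
      intervalIntegral.integral_const_mul] at hF
    have hF' : ∫ x in (0:ℝ)..s, x ^ (n + 1) * iteratedDeriv (n + 1) u x =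
      s ^ (n + 1) * iteratedDeriv n u s -
        ((n + 1 : ℕ) : ℝ) * ∫ x in (0:ℝ)..s, x ^ n * iteratedDeriv n u x := by linarith
    rw [hF']
    simp only [Nat.add_sub_cancel]
    field_simp
    ring

/-- The integrand after substitution of the weights. -/
def auxG (β : ℝ) (f : ℝ → ℝ) : ℝ → ℝ≥0∞ :=
  fun σ => ‖Set.indicator (Set.Ioo (0:ℝ) 1) (fun s => s ^ β * f s) σ‖ₑ

lemma auxG_meas (β : ℝ) (f : ℝ → ℝ) (hf : ContinuousOn f (Set.Ioo 0 1)) :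
    Measurable (auxG β f) := by
  have : Measurable (Set.indicator (Set.Ioo (0:ℝ) 1) (fun s => s ^ β * f s)) := by
    apply aux_meas
    refine ContinuousOn.mul ?_ hf
    exact continuousOn_id.rpow_const fun x hx => Or.inl hx.1.ne'
  exact this.enorm

lemma auxG_eq (β : ℝ) (f : ℝ → ℝ) (s : ℝ) (hs : s ∈ Set.Ioo (0:ℝ) 1) :
    auxG β f s = ‖s ^ β * f s‖ₑ := by
  rw [auxG, Set.indicator_of_mem hs]

lemma aux_pointwise (j : ℕ) (β r κ : ℝ) (hκ : κ = (j:ℝ) + 1 - β - r)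
    (u : ℝ → ℝ) (hu : ContDiffOn ℝ (⊤ : ℕ∞) u (Set.Ioo 0 1))
    (hH : ∀ s ∈ Set.Ioo (0:ℝ) 1, ∫⁻ σ in Set.Ioo 0 s, ENNReal.ofReal (σ ^ (κ - 1)) *
      (ENNReal.ofReal (σ ^ r) * auxG β (iteratedDeriv j u) σ) < ⊤) :
    ∀ s ∈ Set.Ioo (0:ℝ) 1, ‖s ^ β * iteratedDeriv j (avgOp u) s‖ₑ ≤
      ENNReal.ofReal (s ^ (-κ - r)) * ∫⁻ σ in Set.Ioo 0 s, ENNReal.ofReal (σ ^ (κ - 1)) *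
        (ENNReal.ofReal (σ ^ r) * auxG β (iteratedDeriv j u) σ) := by
  have hfc := (aux_iter u hu j).1
  have key : ∀ s ∈ Set.Ioo (0:ℝ) 1, ∫⁻ σ in Set.Ioo 0 s, ENNReal.ofReal (σ ^ (κ - 1)) *
      (ENNReal.ofReal (σ ^ r) * auxG β (iteratedDeriv j u) σ) =
      ∫⁻ σ in Set.Ioo 0 s, ‖σ ^ j * iteratedDeriv j u σ‖ₑ := by
    intro s hs
    refine setLIntegral_congr_fun measurableSet_Ioo fun σ hσ => ?_
    have hσ0 := hσ.1
    rw [auxG_eq β _ σ ⟨hσ.1, hσ.2.trans hs.2⟩, enorm_mul, enorm_mul, ← mul_assoc, ← mul_assoc]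
    congr 1
    rw [Real.enorm_eq_ofReal (by positivity), Real.enorm_eq_ofReal (by positivity),
      ← ENNReal.ofReal_mul (by positivity), ← ENNReal.ofReal_mul (by positivity),
      ← Real.rpow_add hσ0, ← Real.rpow_add hσ0, ← Real.rpow_natCast]
    congr 2
    rw [hκ]; ring
  have hint : ∀ c ∈ Set.Ioo (0:ℝ) 1,
      IntervalIntegrable (fun x => x ^ j * iteratedDeriv j u x) volume 0 c := by
    intro c hc
    rw [intervalIntegrable_iff_integrableOn_Ioo_of_le hc.1.le]
    refine ⟨(((continuous_pow j).continuousOn.mul hfc).mono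
      (Set.Ioo_subset_Ioo_right hc.2.le)).aestronglyMeasurable measurableSet_Ioo, ?_⟩
    have := hH c hc
    rw [key c hc] at this
    exact this
  intro s hs
  have hs0 := hs.1
  rw [aux_formula u hu j hint s hs, key s hs, ← mul_assoc, enorm_mul,
    intervalIntegral.integral_of_le hs0.le, integral_Ioc_eq_integral_Ioo]
  refine mul_le_mul' (le_of_eq ?_) (enorm_integral_le_lintegral_enorm _)
  rw [Real.enorm_eq_ofReal (by positivity)]
  congr 1
  rw [← Real.rpow_natCast, ← Real.rpow_neg hs0.le, ← Real.rpow_add hs0]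
  congr 1
  rw [hκ]; push_cast; ring

lemma aux_main (j : ℕ) (p : ℝ≥0∞) (β : ℝ) (hp : 1 ≤ p) (hβ : β < (j : ℝ) + 1 - p.toReal⁻¹)
    (u : ℝ → ℝ) (hu : ContDiffOn ℝ (⊤ : ℕ∞) u (Set.Ioo 0 1))
    (hfin : eLpNorm (fun s => s ^ β * iteratedDeriv j u s) p
      (volume.restrict (Set.Ioo (0:ℝ) 1)) ≠ ⊤) :
    eLpNorm (fun s => s ^ β * iteratedDeriv j (avgOp u) s) p
        (volume.restrict (Set.Ioo (0:ℝ) 1)) ≤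
      ENNReal.ofReal (((j : ℝ) + 1 - β - p.toReal⁻¹)⁻¹) *
        eLpNorm (fun s => s ^ β * iteratedDeriv j u s) p
          (volume.restrict (Set.Ioo (0:ℝ) 1)) := by
  set κ : ℝ := (j : ℝ) + 1 - β - p.toReal⁻¹ with hκ
  have hκ0 : 0 < κ := by rw [hκ]; linarith
  have hfc := (aux_iter u hu j).1
  have hG := auxG_meas β _ hfc
  have hGe := auxG_eq β (iteratedDeriv j u)
  set G := auxG β (iteratedDeriv j u) with hGdef
  have hpt := aux_pointwise j β p.toReal⁻¹ κ hκ u hu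
  by_cases htop : p = ⊤
  · subst htop
    have h0 : (⊤ : ℝ≥0∞).toReal⁻¹ = 0 := by simp
    rw [h0] at hpt
    simp only [eLpNorm_exponent_top] at hfin ⊢
    set N := eLpNormEssSup (fun s => s ^ β * iteratedDeriv j u s)
      (volume.restrict (Set.Ioo (0:ℝ) 1)) with hN
    have hGN : ∀ᵐ s ∂(volume.restrict (Set.Ioo (0:ℝ) 1)), G s ≤ N := by
      filter_upwards [enorm_ae_le_eLpNormEssSup (fun s => s ^ β * iteratedDeriv j u s)
        (volume.restrict (Set.Ioo (0:ℝ) 1)), ae_restrict_mem measurableSet_Ioo] with s h hs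
      rw [hGe s hs]
      exact h
    have hHle : ∀ s ∈ Set.Ioo (0:ℝ) 1, ∫⁻ σ in Set.Ioo 0 s, ENNReal.ofReal (σ ^ (κ - 1)) *
        (ENNReal.ofReal (σ ^ (0:ℝ)) * G σ) ≤ ENNReal.ofReal (s ^ κ / κ) * N := by
      intro s hs
      rw [← aux_pow κ s hκ0 hs.1, ← lintegral_mul_const' _ _ hfin]
      refine lintegral_mono_ae ?_
      filter_upwards [ae_restrict_of_ae_restrict_of_subset
        (Set.Ioo_subset_Ioo_right hs.2.le) hGN] with σ hσ
      simp only [Real.rpow_zero, ENNReal.ofReal_one, one_mul]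
      gcongr
    have hpt' := hpt fun s hs => (hHle s hs).trans_lt
      (ENNReal.mul_lt_top ENNReal.ofReal_lt_top hfin.lt_top)
    refine eLpNormEssSup_le_of_ae_enorm_bound ?_
    filter_upwards [ae_restrict_mem measurableSet_Ioo] with s hs
    have hs0 := hs.1
    refine (hpt' s hs).trans ((mul_le_mul_right (hHle s hs) _).trans (le_of_eq ?_))
    rw [← mul_assoc, ← ENNReal.ofReal_mul (by positivity)]
    congr 2
    rw [sub_zero, Real.rpow_neg hs0.le]
    have := (Real.rpow_pos_of_pos hs0 κ).ne'
    field_simp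
  · have hp0 : p ≠ 0 := (zero_lt_one.trans_le hp).ne'
    have hq : 1 ≤ p.toReal := by
      have := ENNReal.toReal_mono htop hp
      simpa using this
    have hq0 : 0 < p.toReal := by linarith
    rw [eLpNorm_eq_lintegral_rpow_enorm_toReal hp0 htop] at hfin
    rw [eLpNorm_eq_lintegral_rpow_enorm_toReal hp0 htop,
      eLpNorm_eq_lintegral_rpow_enorm_toReal hp0 htop]
    set q := p.toReal with hqdef
    have hGq : ∫⁻ s in Set.Ioo (0:ℝ) 1, ‖s ^ β * iteratedDeriv j u s‖ₑ ^ q =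
        ∫⁻ s in Set.Ioo (0:ℝ) 1, G s ^ q :=
      setLIntegral_congr_fun measurableSet_Ioo fun s hs => by simp only [hGe s hs]
    rw [hGq] at hfin ⊢
    have hfin' : ∫⁻ s in Set.Ioo (0:ℝ) 1, G s ^ q ≠ ⊤ := by
      intro h
      rw [h, ENNReal.top_rpow_of_pos (by positivity)] at hfin
      exact hfin rfl
    have hF : Measurable fun σ : ℝ => ENNReal.ofReal (σ ^ q⁻¹) * G σ := by fun_prop
    have hHfin : ∀ s ∈ Set.Ioo (0:ℝ) 1, ∫⁻ σ in Set.Ioo 0 s, ENNReal.ofReal (σ ^ (κ - 1)) *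
        (ENNReal.ofReal (σ ^ q⁻¹) * G σ) < ⊤ := by
      intro s hs
      have hJ := aux_jensen κ q s hκ0 hq hs.1 _ hF
      have hlt : (∫⁻ σ in Set.Ioo 0 s, ENNReal.ofReal (σ ^ (κ - 1)) *
        (ENNReal.ofReal (σ ^ q⁻¹) * G σ) ^ q) < ⊤ := by
        refine lt_of_le_of_lt ?_ hfin'.lt_top
        refine le_trans ?_ (lintegral_mono_set (Set.Ioo_subset_Ioo_right hs.2.le))
        refine setLIntegral_mono' measurableSet_Ioo fun σ hσ => ?_
        have hσ0 := hσ.1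
        rw [ENNReal.mul_rpow_of_nonneg _ _ hq0.le,
            ENNReal.ofReal_rpow_of_nonneg (by positivity) (by linarith), ← Real.rpow_mul hσ0.le,
            inv_mul_cancel₀ hq0.ne', ← mul_assoc, ← ENNReal.ofReal_mul (by positivity),
            ← Real.rpow_add hσ0, sub_add_cancel]
        refine mul_le_of_le_one_left' (ENNReal.ofReal_le_one.2 ?_)
        exact Real.rpow_le_one hσ0.le (hσ.2.trans hs.2).le hκ0.le
      have hlt2 := hJ.trans_lt (ENNReal.mul_lt_top hlt
        (ENNReal.rpow_lt_top_of_nonneg (by linarith) ENNReal.ofReal_ne_top))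
      by_contra hcon
      rw [not_lt, top_le_iff] at hcon
      rw [hcon, ENNReal.top_rpow_of_pos hq0] at hlt2
      exact lt_irrefl _ hlt2
    have hpt' := hpt hHfin
    have hle : ∫⁻ s in Set.Ioo (0:ℝ) 1, ‖s ^ β * iteratedDeriv j (avgOp u) s‖ₑ ^ q ≤
        ENNReal.ofReal κ⁻¹ ^ q * ∫⁻ s in Set.Ioo (0:ℝ) 1, G s ^ q := by
      refine le_trans ?_ (aux_hardy κ q hκ0 hq G hG)
      refine setLIntegral_mono' measurableSet_Ioo fun s hs => ?_
      exact ENNReal.rpow_le_rpow (hpt' s hs) hq0.le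
    refine (ENNReal.rpow_le_rpow hle (by positivity)).trans (le_of_eq ?_)
    rw [ENNReal.mul_rpow_of_nonneg _ _ (by positivity), ← ENNReal.rpow_mul,
      mul_one_div_cancel hq0.ne', ENNReal.rpow_one]

lemma aux_wL2 (α : ℝ) (v : ℝ → ℝ) :
    wL2 α v = eLpNorm (fun s => s ^ α * v s) 2 (volume.restrict (Set.Ioo (0:ℝ) 1)) := by
  rw [eLpNorm_eq_lintegral_rpow_enorm_toReal (by norm_num) (by norm_num), wL2]
  simp only [ENNReal.toReal_ofNat]
  congr 1
  refine setLIntegral_congr_fun measurableSet_Ioo fun s hs => ?_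
  have hs0 := hs.1
  rw [← ofReal_norm, ENNReal.ofReal_rpow_of_nonneg (norm_nonneg _) (by norm_num)]
  congr 1
  rw [norm_mul, Real.mul_rpow (norm_nonneg _) (norm_nonneg _), 
    Real.norm_of_nonneg (by positivity : 0 ≤ s ^ α), ← Real.rpow_mul hs0.le, mul_comm α, Real.rpow_ofNat]

lemma aux_wL2_le (α : ℝ) (n : ℕ) (h : α + 1 ≤ (n : ℝ) + 1) (u : ℝ → ℝ)
    (hu : ContDiffOn ℝ (⊤ : ℕ∞) u (Set.Ioo 0 1)) :
    wL2 α (iteratedDeriv n (avgOp u)) ^ 2 ≤ 4 * wL2 α (iteratedDeriv n u) ^ 2 := by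
  have key : wL2 α (iteratedDeriv n (avgOp u)) ≤ 2 * wL2 α (iteratedDeriv n u) := by
    rw [aux_wL2, aux_wL2]
    by_cases hfin : eLpNorm (fun s => s ^ α * iteratedDeriv n u s) 2
      (volume.restrict (Set.Ioo (0:ℝ) 1)) = ⊤
    · rw [hfin]; simp
    · have h2 : (2 : ℝ≥0∞).toReal⁻¹ = 1 / 2 := by simp
      refine (aux_main n 2 α (by norm_num) (by rw [h2]; linarith) u hu hfin).trans ?_
      gcongr
      rw [h2]
      refine (ENNReal.ofReal_le_ofReal (q := 2) ?_).trans (by simp)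
      rw [inv_le_comm₀ (by linarith) (by norm_num)]
      linarith
  calc _ ≤ (2 * wL2 α (iteratedDeriv n u)) ^ 2 := by gcongr
    _ = _ := by rw [mul_pow]; norm_num

lemma aux_Xnorm (m : ℕ) (u : ℝ → ℝ) (hu : ContDiffOn ℝ (⊤ : ℕ∞) u (Set.Ioo 0 1)) :
    Xnorm m (avgOp u) ≤ 2 * Xnorm m u := by
  have key : XnormSq m (avgOp u) ≤ 4 * XnormSq m u := by
    unfold XnormSq
    split_ifs
    all_goals
      rw [mul_add, Finset.mul_sum, Finset.mul_sum]
      refine add_le_add (Finset.sum_le_sum fun i _ => ?_) (Finset.sum_le_sum fun i _ => ?_)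
    · exact aux_wL2_le _ _ (by linarith [(Nat.cast_nonneg i : (0:ℝ) ≤ i)]) u hu
    · refine aux_wL2_le _ _ ?_ u hu
      push_cast
      linarith [(Nat.cast_nonneg (m / 2) : (0:ℝ) ≤ ((m / 2 : ℕ) : ℝ))]
    · exact aux_wL2_le _ _ (by linarith [(Nat.cast_nonneg i : (0:ℝ) ≤ i)]) u hu
    · refine aux_wL2_le _ _ ?_ u hu
      push_cast
      linarith [(Nat.cast_nonneg (m / 2) : (0:ℝ) ≤ ((m / 2 : ℕ) : ℝ))]
  unfold Xnorm
  refine (ENNReal.rpow_le_rpow key (by norm_num)).trans (le_of_eq ?_)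
  rw [ENNReal.mul_rpow_of_nonneg _ _ (by norm_num)]
  congr 1
  rw [show (4 : ℝ≥0∞) = 2 ^ (2:ℝ) by norm_num, ← ENNReal.rpow_mul]
  norm_num

/-- bounds for the averaging operator:
`‖s^β ∂^j (Mu)‖_{L^p} ≤ (j+1-β-1/p)⁻¹ ‖s^β ∂^j u‖_{L^p}` for `β < j+1-1/p`, and in particular
`‖Mu‖_{X^m} ≤ 2 ‖u‖_{X^m}`. -/
theorem stmt16 :
    (∀ (j : ℕ) (p : ℝ≥0∞) (β : ℝ), 1 ≤ p → β < (j : ℝ) + 1 - p.toReal⁻¹ →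
      ∀ u : ℝ → ℝ, ContDiffOn ℝ (⊤ : ℕ∞) u (Set.Ioo 0 1) →
        eLpNorm (fun s => s ^ β * iteratedDeriv j u s) p (volume.restrict (Set.Ioo (0:ℝ) 1)) ≠ ⊤ →
        eLpNorm (fun s => s ^ β * iteratedDeriv j (avgOp u) s) p
            (volume.restrict (Set.Ioo (0:ℝ) 1)) ≤
          ENNReal.ofReal (((j : ℝ) + 1 - β - p.toReal⁻¹)⁻¹) *
            eLpNorm (fun s => s ^ β * iteratedDeriv j u s) p
              (volume.restrict (Set.Ioo (0:ℝ) 1))) ∧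
    (∀ (m : ℕ) (u : ℝ → ℝ), ContDiffOn ℝ (⊤ : ℕ∞) u (Set.Ioo 0 1) →
      Xnorm m (avgOp u) ≤ 2 * Xnorm m u) := by
  exact ⟨aux_main, aux_Xnorm⟩
end
end

section
/- For every M > 0 there exists a constant C = C(M) > 0 with the following property: let v : (0,1) → ℝ³ be measurable with (∫₀¹ s |v(s)|² ds)^{1/2} ≤ M, let h be an integrable function on (0,1), let a ∈ ℝ, and suppose τ ∈ C²([0,1]) solves the two-point boundary value problem -τ''(s) + |v(s)|² τ(s) = h(s) on (0,1), τ(0) = 0, τ'(1) = a. Then sup_{0≤s≤1} |τ(s)| ≤ C ( |a| + ∫₀¹ s |h(s)| ds ), and for every p ∈ [1, ∞] and every α ≥ 0 with α + 1/p ≤ 1 one has ‖s^α τ'‖_{L^p(0,1)} ≤ C ( |a| + ∫₀¹ s^{α + 1/p} |h(s)| ds ). -/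
open MeasureTheory ENNReal RealInnerProductSpace

noncomputable section

lemma aux_max_s17 (t t1 t2 h : ℝ → ℝ) (h1 : ∀ s, HasDerivAt t (t1 s) s)
    (h2 : ∀ s, HasDerivAt t1 (t2 s) s) (hc : Continuous t2)
    (hh : IntervalIntegrable (fun s => |h s|) volume 0 1)
    (hineq : ∀ s ∈ Set.Ioo (0:ℝ) 1, 0 < t s → -t2 s ≤ |h s|) (ht0 : t 0 = 0)
    (s0 : ℝ) (hs0 : s0 ∈ Set.Ioc (0:ℝ) 1) (hpos : 0 < t s0) :
    t s0 ≤ s0 * |t1 1| + ∫ σ in (0:ℝ)..1, min s0 σ * |h σ| := by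
  obtain ⟨h0, h01⟩ := hs0
  have ct : Continuous t := continuous_iff_continuousAt.2 fun s => (h1 s).continuousAt
  have ct1 : Continuous t1 := continuous_iff_continuousAt.2 fun s => (h2 s).continuousAt
  obtain ⟨x, ⟨hx, hxm⟩⟩ : ∃ x, IsGreatest (Set.Icc 0 s0 ∩ {r | t r ≤ 0}) x := by
    apply IsCompact.exists_isGreatest
    · exact isCompact_Icc.inter_right (isClosed_le ct continuous_const)
    · exact ⟨0, ⟨le_rfl, h0.le⟩, by simp [ht0]⟩
  obtain ⟨⟨hx0, hxs⟩, hxt⟩ := hx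
  simp only [Set.mem_ofPred_eq] at hxt
  have hposx : ∀ s, x < s → s ≤ s0 → 0 < t s := by
    intro s hs hs'
    by_contra hcon
    exact absurd (hxm ⟨⟨hx0.trans hs.le, hs'⟩, not_lt.1 hcon⟩) (not_le.2 hs)
  obtain ⟨y, hsy, hy1, hya, hposy⟩ : ∃ y, s0 ≤ y ∧ y ≤ 1 ∧ t1 y ≤ |t1 1| ∧
      ∀ s, s0 ≤ s → s < y → 0 < t s := by
    by_cases hne : (Set.Icc s0 1 ∩ {r | t r ≤ 0}).Nonempty
    · obtain ⟨y, ⟨⟨hy, hyt⟩, hym⟩⟩ : ∃ y, IsLeast (Set.Icc s0 1 ∩ {r | t r ≤ 0}) y :=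
        (isCompact_Icc.inter_right (isClosed_le ct continuous_const)).exists_isLeast hne
      simp only [Set.mem_ofPred_eq] at hyt
      have hlt : s0 < y := lt_of_le_of_ne hy.1 (by rintro rfl; linarith)
      obtain ⟨c, hc1, hc2⟩ := exists_hasDerivAt_eq_slope t t1 hlt ct.continuousOn
        (fun s _ => h1 s)
      refine ⟨c, hc1.1.le, hc1.2.le.trans hy.2, ?_, ?_⟩
      · rw [hc2]
        refine le_trans ?_ (abs_nonneg _)
        apply div_nonpos_of_nonpos_of_nonneg <;> linarith
      · intro s hs hs'
        by_contra hcon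
        have := hym ⟨⟨hs, (hs'.trans hc1.2).le.trans hy.2⟩, not_lt.1 hcon⟩
        linarith [hc1.2]
    · refine ⟨1, h01, le_rfl, le_abs_self _, fun s hs hs' => ?_⟩
      by_contra hcon
      exact hne ⟨s, ⟨hs, hs'.le⟩, not_lt.1 hcon⟩
  have i0 : IntervalIntegrable (fun σ => min s0 σ * |h σ|) volume 0 1 :=
    hh.continuousOn_mul (by fun_prop)
  have sub : ∀ c d : ℝ, 0 ≤ c → c ≤ d → d ≤ 1 →
      IntervalIntegrable (fun σ => min s0 σ * |h σ|) volume c d := by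
    intro c d hc hcd hd
    apply i0.mono_set
    rw [Set.uIcc_of_le hcd, Set.uIcc_of_le zero_le_one]
    exact Set.Icc_subset_Icc hc hd
  have e1 : ∫ s in x..s0, -((s - x) * t2 s) = -((s0 - x) * t1 s0 - t s0) + (0 - t x) := by
    rw [intervalIntegral.integral_eq_sub_of_hasDerivAt
      (f := fun s => -((s - x) * t1 s - t s))]
    · ring
    · intro s _
      have := ((((hasDerivAt_id s).sub_const x).mul (h2 s)).sub (h1 s)).neg
      refine (this.congr_deriv ?_)
      simp only [id]; ring
    · exact Continuous.intervalIntegrable (by fun_prop) _ _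
  have e2 : ∫ s in s0..y, -((s0 - x) * t2 s) = -((s0 - x) * t1 y) + (s0 - x) * t1 s0 := by
    rw [intervalIntegral.integral_eq_sub_of_hasDerivAt
      (f := fun s => -((s0 - x) * t1 s))]
    · ring
    · intro s _
      exact ((h2 s).const_mul (s0 - x)).neg
    · exact Continuous.intervalIntegrable (by fun_prop) _ _
  have b1 : ∫ s in x..s0, -((s - x) * t2 s) ≤ ∫ s in x..s0, min s0 s * |h s| := by
    apply intervalIntegral.integral_mono_on_of_le_Ioo hxs
    · exact Continuous.intervalIntegrable (by fun_prop) _ _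
    · exact sub _ _ hx0 hxs h01
    · intro s hs
      rw [min_eq_right hs.2.le]
      have := hineq s ⟨hx0.trans_lt hs.1, hs.2.trans_le h01⟩ (hposx s hs.1 hs.2.le)
      have a1 := hs.1
      calc -((s - x) * t2 s) = (s - x) * (-t2 s) := by ring
        _ ≤ (s - x) * |h s| := by gcongr
        _ ≤ s * |h s| := by gcongr; linarith
  have b2 : ∫ s in s0..y, -((s0 - x) * t2 s) ≤ ∫ s in s0..y, min s0 s * |h s| := by
    apply intervalIntegral.integral_mono_on_of_le_Ioo hsy
    · exact Continuous.intervalIntegrable (by fun_prop) _ _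
    · exact sub _ _ h0.le hsy hy1
    · intro s hs
      rw [min_eq_left hs.1.le]
      have := hineq s ⟨h0.trans hs.1, hs.2.trans_le hy1⟩ (hposy s hs.1.le hs.2)
      calc -((s0 - x) * t2 s) = (s0 - x) * (-t2 s) := by ring
        _ ≤ (s0 - x) * |h s| := by gcongr
        _ ≤ s0 * |h s| := by gcongr; linarith
  have b3 : (∫ s in x..s0, min s0 s * |h s|) + (∫ s in s0..y, min s0 s * |h s|)
      ≤ ∫ s in (0:ℝ)..1, min s0 s * |h s| := by
    rw [intervalIntegral.integral_add_adjacent_intervals (sub _ _ hx0 hxs h01)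
      (sub _ _ h0.le hsy hy1)]
    apply intervalIntegral.integral_mono_interval hx0 (hxs.trans hsy) hy1 _ i0
    filter_upwards [ae_restrict_mem measurableSet_Ioc] with s hs
    have : 0 ≤ min s0 s := le_min h0.le hs.1.le
    simp only [Pi.zero_apply]
    positivity
  have b4 : (s0 - x) * t1 y ≤ s0 * |t1 1| :=
    calc (s0 - x) * t1 y ≤ (s0 - x) * |t1 1| := by gcongr
      _ ≤ _ := by gcongr; linarith
  linarith

lemma min_rpow_le {x y b : ℝ} (hx : 0 < x) (hy : 0 < y) (b0 : 0 ≤ b) (b1 : b ≤ 1) :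
    x ^ b * min x y ≤ x * y ^ b := by
  rcases le_total x y with hxy | hxy
  · rw [min_eq_left hxy, mul_comm]
    gcongr
  · rw [min_eq_right hxy]
    calc x ^ b * y = x ^ b * (y ^ (1 - b) * y ^ b) := by
          rw [← Real.rpow_add hy]; simp
      _ ≤ x ^ b * (x ^ (1 - b) * y ^ b) := by
          gcongr
      _ = x * y ^ b := by rw [← mul_assoc, ← Real.rpow_add hx]; simp

lemma aux_w (t t1 t2 h : ℝ → ℝ) (h1 : ∀ s, HasDerivAt t (t1 s) s)
    (h2 : ∀ s, HasDerivAt t1 (t2 s) s) (hc : Continuous t2)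
    (hh : IntervalIntegrable (fun s => |h s|) volume 0 1)
    (hineq : ∀ s ∈ Set.Ioo (0:ℝ) 1, 0 < t s → -t2 s ≤ |h s|)
    (hineq' : ∀ s ∈ Set.Ioo (0:ℝ) 1, t s < 0 → t2 s ≤ |h s|) (ht0 : t 0 = 0)
    (b : ℝ) (b0 : 0 ≤ b) (b1 : b ≤ 1)
    (s0 : ℝ) (hs0 : s0 ∈ Set.Ioc (0:ℝ) 1) :
    s0 ^ b * |t s0| ≤ s0 * (|t1 1| + ∫ σ in (0:ℝ)..1, σ ^ b * |h σ|) := by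
  obtain ⟨h0, h01⟩ := hs0
  have I0 : 0 ≤ ∫ σ in (0:ℝ)..1, min s0 σ * |h σ| := by
    apply intervalIntegral.integral_nonneg zero_le_one
    intro s hs
    have : 0 ≤ min s0 s := le_min h0.le hs.1
    positivity
  have key : |t s0| ≤ s0 * |t1 1| + ∫ σ in (0:ℝ)..1, min s0 σ * |h σ| := by
    rcases lt_trichotomy (t s0) 0 with hn | hz | hp
    · rw [abs_of_neg hn]
      have := aux_max_s17 (fun s => -t s) (fun s => -t1 s) (fun s => -t2 s) h
        (fun s => (h1 s).neg) (fun s => (h2 s).neg) hc.neg hh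
        (fun s hs hs' => by simpa using hineq' s hs (by simpa using hs')) (by simp [ht0])
        s0 ⟨h0, h01⟩ (by simpa using hn)
      simpa using this
    · rw [hz]; simp only [abs_zero]; positivity
    · rw [abs_of_pos hp]
      exact aux_max_s17 t t1 t2 h h1 h2 hc hh hineq ht0 s0 ⟨h0, h01⟩ hp
  have hI : s0 ^ b * ∫ σ in (0:ℝ)..1, min s0 σ * |h σ| ≤
      s0 * ∫ σ in (0:ℝ)..1, σ ^ b * |h σ| := by
    rw [← intervalIntegral.integral_const_mul, ← intervalIntegral.integral_const_mul]
    apply intervalIntegral.integral_mono_on_of_le_Ioo zero_le_one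
    · exact (hh.continuousOn_mul (by fun_prop)).const_mul _
    · exact (hh.continuousOn_mul (Real.continuous_rpow_const b0).continuousOn).const_mul _
    · intro s hs
      rw [← mul_assoc, ← mul_assoc]
      exact mul_le_mul_of_nonneg_right (min_rpow_le h0 hs.1 b0 b1) (abs_nonneg _)
  have hs1 : s0 ^ b ≤ 1 := Real.rpow_le_one h0.le h01 b0
  have hA : s0 ^ b * (s0 * |t1 1|) ≤ s0 * |t1 1| :=
    mul_le_of_le_one_left (by positivity) hs1
  calc s0 ^ b * |t s0| ≤ s0 ^ b * (s0 * |t1 1| + ∫ σ in (0:ℝ)..1, min s0 σ * |h σ|) := by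
        gcongr
    _ ≤ _ := by rw [mul_add, mul_add]; exact add_le_add hA hI

/-- Hardy type bound. -/
lemma aux_hardy_s17 (k : ℝ → ℝ) (hk : Continuous k) (hk0 : ∀ s, 0 ≤ k s) (p : ℝ≥0∞) (α : ℝ)
    (hp : 1 ≤ p) (hα : 0 ≤ α) :
    eLpNorm (fun s => s ^ α * ∫ σ in s..1, k σ) p (volume.restrict (Set.Ioo (0:ℝ) 1)) ≤
      2 * ∫⁻ σ in Set.Ioo (0:ℝ) 1, ENNReal.ofReal (σ ^ (α + p.toReal⁻¹) * k σ) := by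
  set b := α + p.toReal⁻¹ with hb
  have hb0 : 0 ≤ b := by positivity
  set K := ∫⁻ σ in Set.Ioo (0:ℝ) 1, ENNReal.ofReal (σ ^ b * k σ) with hK
  have hF : ∀ s ∈ Set.Ioo (0:ℝ) 1, ENNReal.ofReal (∫ σ in s..1, k σ) =
      ∫⁻ σ in Set.Ioo (0:ℝ) 1, (Set.Ioi s).indicator (fun σ => ENNReal.ofReal (k σ)) σ := by
    intro s hs
    rw [intervalIntegral.integral_of_le hs.2.le, integral_Ioc_eq_integral_Ioo,
      ofReal_integral_eq_lintegral_ofReal, lintegral_indicator measurableSet_Ioi,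
      Measure.restrict_restrict measurableSet_Ioi]
    · congr 2
      ext u; simp only [Set.mem_Ioo, Set.mem_inter_iff, Set.mem_Ioi]
      constructor
      · rintro ⟨h1, h2⟩; exact ⟨h1, hs.1.trans h1, h2⟩
      · rintro ⟨h1, _, h2⟩; exact ⟨h1, h2⟩
    · exact (hk.integrableOn_Icc (a := s) (b := 1)).mono_set Set.Ioo_subset_Icc_self
    · exact Filter.Eventually.of_forall hk0
  have hF0 : ∀ s ∈ Set.Ioo (0:ℝ) 1, 0 ≤ ∫ σ in s..1, k σ := fun s hs =>
    intervalIntegral.integral_nonneg hs.2.le fun u _ => hk0 u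
  -- pointwise bound
  have hpt : ∀ s ∈ Set.Ioo (0:ℝ) 1, ENNReal.ofReal (s ^ b * ∫ σ in s..1, k σ) ≤ K := by
    intro s hs
    rw [ENNReal.ofReal_mul (by have := hs.1; positivity), hF s hs,
      ← lintegral_const_mul' _ _ ENNReal.ofReal_ne_top]
    apply lintegral_mono
    intro u
    by_cases hu : s < u
    · have := hs.1
      simp only [Set.indicator, Set.mem_Ioi, hu, if_true]
      rw [← ENNReal.ofReal_mul (by positivity)]
      apply ENNReal.ofReal_le_ofReal
      have := hk0 u
      gcongr
    · simp [Set.indicator, hu]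
  rcases eq_or_ne p ∞ with rfl | hpt'
  · have hbα : b = α := by simp [hb]
    rw [hbα] at hpt
    refine le_trans ?_ (le_mul_of_one_le_left (zero_le) (one_le_two))
    rw [eLpNorm_exponent_top]
    apply eLpNormEssSup_le_of_ae_enorm_bound
    filter_upwards [ae_restrict_mem measurableSet_Ioo] with s hs
    rw [Real.enorm_of_nonneg (mul_nonneg (Real.rpow_nonneg hs.1.le _) (hF0 s hs))]
    exact hpt s hs
  -- finite p
  set r := p.toReal with hr
  have hr1 : 1 ≤ r := by
    rw [hr]; simpa using ENNReal.toReal_mono hpt' hp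
  have hr0 : 0 < r := by linarith
  have hbpos : 0 < b := by positivity
  rw [eLpNorm_eq_lintegral_rpow_enorm_toReal (by positivity) hpt', ← hr]
  have hT : ∫⁻ s in Set.Ioo (0:ℝ) 1, ENNReal.ofReal (s ^ (b - 1)) *
      ENNReal.ofReal (∫ σ in s..1, k σ) ≤ ENNReal.ofReal r * K := by
    calc _ = ∫⁻ s in Set.Ioo (0:ℝ) 1, ∫⁻ σ in Set.Ioo (0:ℝ) 1, ENNReal.ofReal (s ^ (b - 1)) *
          (Set.Ioi s).indicator (fun σ => ENNReal.ofReal (k σ)) σ := by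
          apply setLIntegral_congr_fun measurableSet_Ioo
          intro s hs
          simp only
          rw [hF s hs, ← lintegral_const_mul' _ _ ENNReal.ofReal_ne_top]
      _ = ∫⁻ σ in Set.Ioo (0:ℝ) 1, ∫⁻ s in Set.Ioo (0:ℝ) 1, ENNReal.ofReal (s ^ (b - 1)) *
          (Set.Ioi s).indicator (fun σ => ENNReal.ofReal (k σ)) σ := by
          apply lintegral_lintegral_swap
          apply Measurable.aemeasurable
          have : (Function.uncurry fun s σ => ENNReal.ofReal (s ^ (b - 1)) *
              (Set.Ioi s).indicator (fun σ => ENNReal.ofReal (k σ)) σ) =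
              fun z : ℝ × ℝ => ENNReal.ofReal (z.1 ^ (b - 1)) *
              {z : ℝ × ℝ | z.1 < z.2}.indicator (fun z => ENNReal.ofReal (k z.2)) z := by
            ext z
            rfl
          rw [this]
          apply Measurable.mul
          · fun_prop
          · apply Measurable.indicator
            · have := hk.measurable
              fun_prop
            · exact measurableSet_lt measurable_fst measurable_snd
      _ ≤ ∫⁻ σ in Set.Ioo (0:ℝ) 1, ENNReal.ofReal r * ENNReal.ofReal (σ ^ b * k σ) := by
          apply setLIntegral_mono' measurableSet_Ioo
          intro u hu
          have hu0 := hu.1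
          calc _ = ∫⁻ s in Set.Ioo (0:ℝ) 1, (Set.Iio u).indicator
                (fun s => ENNReal.ofReal (s ^ (b-1)) * ENNReal.ofReal (k u)) s := by
                congr 1
                ext s
                by_cases hsu : s < u <;> simp [Set.indicator, hsu]
            _ = (∫⁻ s in Set.Ioo (0:ℝ) u, ENNReal.ofReal (s ^ (b-1))) * ENNReal.ofReal (k u) := by
                rw [lintegral_indicator measurableSet_Iio,
                  Measure.restrict_restrict measurableSet_Iio,
                  lintegral_mul_const' _ _ ENNReal.ofReal_ne_top]
                congr 3
                ext s; simp only [Set.mem_Ioo, Set.mem_inter_iff, Set.mem_Iio]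
                constructor
                · rintro ⟨h1, h2, _⟩; exact ⟨h2, h1⟩
                · rintro ⟨h1, h2⟩; exact ⟨h2, h1, h2.trans hu.2⟩
            _ = ENNReal.ofReal (u ^ b / b) * ENNReal.ofReal (k u) := by
                congr 1
                rw [← ofReal_integral_eq_lintegral_ofReal, ← integral_Ioc_eq_integral_Ioo,
                  ← intervalIntegral.integral_of_le hu0.le, integral_rpow (Or.inl (by linarith))]
                · simp [Real.zero_rpow hbpos.ne']
                · have := intervalIntegral.intervalIntegrable_rpow' (a := 0) (b := u)
                    (r := b - 1) (by linarith)
                  rw [intervalIntegrable_iff_integrableOn_Ioo_of_le hu0.le] at this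
                  exact this
                · filter_upwards [ae_restrict_mem measurableSet_Ioo] with s hs
                  exact Real.rpow_nonneg hs.1.le _
            _ ≤ _ := by
                rw [← ENNReal.ofReal_mul (by positivity), ← ENNReal.ofReal_mul (by positivity)]
                apply ENNReal.ofReal_le_ofReal
                have hbr : b⁻¹ ≤ r := by
                  rw [inv_le_comm₀ hbpos hr0, hb]; linarith
                have := hk0 u
                calc u ^ b / b * k u = b⁻¹ * (u ^ b * k u) := by ring
                  _ ≤ _ := by gcongr
      _ = _ := by rw [lintegral_const_mul' _ _ ENNReal.ofReal_ne_top]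
  have hmain : ∫⁻ s in Set.Ioo (0:ℝ) 1, ‖s ^ α * ∫ σ in s..1, k σ‖ₑ ^ r ≤ (2 * K) ^ r := by
    calc _ ≤ ∫⁻ s in Set.Ioo (0:ℝ) 1, K ^ (r - 1) * (ENNReal.ofReal (s ^ (b - 1)) *
          ENNReal.ofReal (∫ σ in s..1, k σ)) := by
          apply setLIntegral_mono' measurableSet_Ioo
          intro s hs
          have hs0 := hs.1
          have hFs := hF0 s hs
          set f := ∫ σ in s..1, k σ
          rw [Real.enorm_of_nonneg (by positivity)]
          calc ENNReal.ofReal (s ^ α * f) ^ r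
              = ENNReal.ofReal (s ^ b * f) ^ (r - 1) *
                (ENNReal.ofReal (s ^ (b - 1)) * ENNReal.ofReal f) := by
                rw [ENNReal.ofReal_rpow_of_nonneg (by positivity) hr0.le,
                  ENNReal.ofReal_rpow_of_nonneg (by positivity) (by linarith),
                  ← ENNReal.ofReal_mul (by positivity), ← ENNReal.ofReal_mul (by positivity)]
                congr 1
                rw [Real.mul_rpow (by positivity) hFs, Real.mul_rpow (by positivity) hFs,
                  ← Real.rpow_mul hs0.le, ← Real.rpow_mul hs0.le]
                have e1 : f ^ r = f ^ (r - 1) * f := by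
                  conv_lhs => rw [show r = (r - 1) + 1 by ring]
                  rw [Real.rpow_add_of_nonneg hFs (by linarith) zero_le_one, Real.rpow_one]
                have e2 : s ^ (α * r) = s ^ (b * (r - 1)) * s ^ (b - 1) := by
                  rw [← Real.rpow_add hs0]
                  congr 1
                  rw [hb]; field_simp; ring
                rw [e1, e2]; ring
            _ ≤ _ := by
                gcongr
                exact hpt s hs
      _ ≤ ∫⁻ s in Set.Ioo (0:ℝ) 1, K ^ (r - 1) * (ENNReal.ofReal (s ^ (b - 1)) *
          ENNReal.ofReal (∫ σ in s..1, k σ)) := le_rfl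
      _ = K ^ (r - 1) * ∫⁻ s in Set.Ioo (0:ℝ) 1, (ENNReal.ofReal (s ^ (b - 1)) *
          ENNReal.ofReal (∫ σ in s..1, k σ)) := by
          apply lintegral_const_mul''
          refine AEMeasurable.fun_mul ?_ ?_
          · exact (by fun_prop : Measurable fun s : ℝ => ENNReal.ofReal (s ^ (b-1))).aemeasurable
          · have : Continuous fun s => ∫ σ in s..1, k σ := by
              have e : (fun s => ∫ σ in s..1, k σ) = fun s => -∫ σ in (1:ℝ)..s, k σ := by
                ext s; rw [intervalIntegral.integral_symm]
              rw [e]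
              exact (intervalIntegral.continuous_primitive
                (fun a b => hk.intervalIntegrable a b) 1).neg
            exact (this.measurable.ennreal_ofReal).aemeasurable
      _ ≤ K ^ (r - 1) * (ENNReal.ofReal r * K) := by gcongr
      _ = ENNReal.ofReal r * K ^ r := by
          have e1 : K ^ r = K ^ (r - 1) * K := by
            conv_lhs => rw [show r = (r - 1) + 1 by ring]
            rw [ENNReal.rpow_add_of_nonneg _ _ (by linarith) zero_le_one, ENNReal.rpow_one]
          rw [e1]; ring
      _ ≤ _ := by
          rw [ENNReal.mul_rpow_of_nonneg _ _ hr0.le]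
          gcongr
          have : (2 : ℝ≥0∞) = ENNReal.ofReal 2 := by simp
          rw [this, ENNReal.ofReal_rpow_of_pos two_pos]
          apply ENNReal.ofReal_le_ofReal
          have := one_add_mul_self_le_rpow_one_add (s := 1) (by norm_num) hr1
          norm_num at this
          linarith
  calc _ ≤ ((2 * K) ^ r) ^ (1 / r) := by gcongr
    _ = 2 * K := by rw [← ENNReal.rpow_mul, mul_one_div_cancel hr0.ne', ENNReal.rpow_one]

theorem stmt17 (M : ℝ) (hM : 0 < M) :
    ∃ C : ℝ, 0 < C ∧
      ∀ (v : ℝ → EuclideanSpace ℝ (Fin 3)) (h : ℝ → ℝ) (a : ℝ) (τ : ℝ → ℝ),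
        AEStronglyMeasurable v (volume.restrict (Set.Ioo (0:ℝ) 1)) →
        wL2 (1/2) v ≤ ENNReal.ofReal M →
        IntegrableOn h (Set.Ioo (0:ℝ) 1) →
        ContDiff ℝ 2 τ →
        (∀ s ∈ Set.Ioo (0:ℝ) 1, -(deriv (deriv τ) s) + ‖v s‖ ^ 2 * τ s = h s) →
        τ 0 = 0 → deriv τ 1 = a →
        (∀ s ∈ Set.Icc (0:ℝ) 1,
          |τ s| ≤ C * (|a| + ∫ σ in Set.Ioo (0:ℝ) 1, σ * |h σ|)) ∧
        (∀ (p : ℝ≥0∞) (α : ℝ), 1 ≤ p → 0 ≤ α → α + p.toReal⁻¹ ≤ 1 →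
          eLpNorm (fun s => s ^ α * deriv τ s) p (volume.restrict (Set.Ioo (0:ℝ) 1)) ≤
            ENNReal.ofReal
              (C * (|a| + ∫ σ in Set.Ioo (0:ℝ) 1, σ ^ (α + p.toReal⁻¹) * |h σ|))) := by
  refine ⟨2 + 2 * M ^ 2, by positivity, ?_⟩
  intro v h a τ _ hv hh hτ heq hτ0 hτ1
  have hd : ContDiff ℝ 1 (deriv τ) := by
    have : ContDiff ℝ (1 + 1) τ := by simpa [one_add_one_eq_two] using hτ
    exact (contDiff_succ_iff_deriv.1 this).2.2
  have h1 : ∀ s, HasDerivAt τ (deriv τ s) s := fun s =>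
    ((hτ.differentiable (by norm_num)) s).hasDerivAt
  have h2 : ∀ s, HasDerivAt (deriv τ) (deriv (deriv τ) s) s := fun s =>
    ((hd.differentiable (by norm_num)) s).hasDerivAt
  have hc : Continuous (deriv (deriv τ)) := hd.continuous_deriv le_rfl
  have hhi : IntervalIntegrable (fun s => |h s|) volume 0 1 := by
    rw [intervalIntegrable_iff_integrableOn_Ioo_of_le zero_le_one]
    exact hh.abs
  have hconv : ∀ f : ℝ → ℝ, ∫ σ in Set.Ioo (0:ℝ) 1, f σ = ∫ σ in (0:ℝ)..1, f σ := by
    intro f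
    rw [intervalIntegral.integral_of_le zero_le_one, integral_Ioc_eq_integral_Ioo]
  have key : ∀ b : ℝ, 0 ≤ b → b ≤ 1 → ∀ s0 ∈ Set.Ioc (0:ℝ) 1,
      s0 ^ b * |τ s0| ≤ s0 * (|a| + ∫ σ in Set.Ioo (0:ℝ) 1, σ ^ b * |h σ|) := by
    intro b b0 b1 s0 hs0
    rw [hconv, ← hτ1]
    refine aux_w τ (deriv τ) (deriv (deriv τ)) h h1 h2 hc hhi ?_ ?_ hτ0 b b0 b1 s0 hs0
    · intro s hs hp
      have := heq s hs
      have : 0 ≤ ‖v s‖ ^ 2 * τ s := by positivity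
      linarith [le_abs_self (h s)]
    · intro s hs hp
      have := heq s hs
      have : 0 ≤ ‖v s‖ ^ 2 * (-τ s) := mul_nonneg (by positivity) (by linarith)
      linarith [neg_abs_le (h s)]
  have hvM : ∫⁻ s in Set.Ioo (0:ℝ) 1, ENNReal.ofReal (s * ‖v s‖ ^ 2) ≤ ENNReal.ofReal (M ^ 2) := by
    have hv' := hv
    unfold wL2 at hv'
    have h3 : ∫⁻ s in Set.Ioo (0:ℝ) 1, ENNReal.ofReal (s * ‖v s‖ ^ 2) =
        ∫⁻ s in Set.Ioo (0:ℝ) 1, ENNReal.ofReal (s ^ (2 * (1 / 2 : ℝ)) * ‖v s‖ ^ 2) := by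
      simp
    rw [h3, ENNReal.ofReal_pow hM.le]
    have h4 := ENNReal.rpow_le_rpow hv' (zero_le_two (α := ℝ))
    rw [← ENNReal.rpow_mul] at h4
    norm_num at h4 ⊢
    exact h4
  have hInn : ∀ b : ℝ, 0 ≤ ∫ σ in Set.Ioo (0:ℝ) 1, σ ^ b * |h σ| := by
    intro b
    apply setIntegral_nonneg measurableSet_Ioo
    intro s hs
    have := hs.1
    positivity
  constructor
  · intro s hs
    have hI := hInn 1
    simp only [Real.rpow_one] at hI
    have hB : |τ s| ≤ |a| + ∫ σ in Set.Ioo (0:ℝ) 1, σ * |h σ| := by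
      rcases hs.1.eq_or_lt with rfl | hs0
      · rw [hτ0]; simp only [abs_zero]; positivity
      · have := key 1 zero_le_one le_rfl s ⟨hs0, hs.2⟩
        simp only [Real.rpow_one] at this
        exact le_of_mul_le_mul_left this hs0
    refine hB.trans (le_mul_of_one_le_left (by positivity) ?_)
    nlinarith
  · intro p α hp hα hb1
    set b := α + p.toReal⁻¹ with hb
    have hb0 : 0 ≤ b := by positivity
    set I := ∫ σ in Set.Ioo (0:ℝ) 1, σ ^ b * |h σ| with hI
    have hI0 : 0 ≤ I := hInn b
    set μ := volume.restrict (Set.Ioo (0:ℝ) 1) with hμ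
    have hF1 : Continuous fun s => ∫ σ in s..1, |deriv (deriv τ) σ| := by
      have e : (fun s => ∫ σ in s..1, |deriv (deriv τ) σ|) =
          fun s => -∫ σ in (1:ℝ)..s, |deriv (deriv τ) σ| := by
        ext s; rw [intervalIntegral.integral_symm]
      rw [e]
      exact (intervalIntegral.continuous_primitive
        (fun a b => hc.abs.intervalIntegrable a b) 1).neg
    have hαc : Continuous fun s : ℝ => s ^ α := Real.continuous_rpow_const hα
    have hK : ∫⁻ σ in Set.Ioo (0:ℝ) 1, ENNReal.ofReal (σ ^ b * |deriv (deriv τ) σ|) ≤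
        ENNReal.ofReal (I + M ^ 2 * (|a| + I)) := by
      have hint : Integrable (fun σ => σ ^ b * |h σ|) μ := by
        have := hhi.continuousOn_mul (g := fun σ : ℝ => σ ^ b)
          (Real.continuous_rpow_const hb0).continuousOn
        rw [intervalIntegrable_iff_integrableOn_Ioo_of_le zero_le_one] at this
        exact this
      calc _ ≤ ∫⁻ σ in Set.Ioo (0:ℝ) 1, (ENNReal.ofReal (σ ^ b * |h σ|) +
            ENNReal.ofReal (|a| + I) * ENNReal.ofReal (σ * ‖v σ‖ ^ 2)) := by
            apply setLIntegral_mono' measurableSet_Ioo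
            intro s hs
            have hs0 := hs.1
            rw [← ENNReal.ofReal_mul (by positivity),
              ← ENNReal.ofReal_add (by positivity) (by positivity)]
            apply ENNReal.ofReal_le_ofReal
            have e : deriv (deriv τ) s = ‖v s‖ ^ 2 * τ s - h s := by linarith [heq s hs]
            have k1 : |deriv (deriv τ) s| ≤ ‖v s‖ ^ 2 * |τ s| + |h s| := by
              rw [e]
              refine (abs_sub _ _).trans ?_
              rw [abs_mul, abs_of_nonneg (by positivity : 0 ≤ ‖v s‖ ^ 2)]
            have k2 := key b hb0 hb1 s ⟨hs0, hs.2.le⟩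
            calc s ^ b * |deriv (deriv τ) s| ≤ s ^ b * (‖v s‖ ^ 2 * |τ s| + |h s|) := by gcongr
              _ = s ^ b * |h s| + ‖v s‖ ^ 2 * (s ^ b * |τ s|) := by ring
              _ ≤ s ^ b * |h s| + ‖v s‖ ^ 2 * (s * (|a| + I)) := by gcongr
              _ = _ := by ring
        _ = ENNReal.ofReal I + ENNReal.ofReal (|a| + I) *
            ∫⁻ σ in Set.Ioo (0:ℝ) 1, ENNReal.ofReal (σ * ‖v σ‖ ^ 2) := by
            rw [lintegral_add_left' hint.aemeasurable.ennreal_ofReal,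
              lintegral_const_mul' _ _ ENNReal.ofReal_ne_top,
              ofReal_integral_eq_lintegral_ofReal hint]
            filter_upwards [ae_restrict_mem measurableSet_Ioo] with s hs
            have := hs.1
            simp only [Pi.zero_apply]
            positivity
        _ ≤ ENNReal.ofReal I + ENNReal.ofReal (|a| + I) * ENNReal.ofReal (M ^ 2) := by gcongr
        _ = _ := by
            rw [← ENNReal.ofReal_mul (by positivity),
              ← ENNReal.ofReal_add (by positivity) (by positivity)]
            congr 1; ring
    calc eLpNorm (fun s => s ^ α * deriv τ s) p μ
        ≤ eLpNorm ((fun s => s ^ α * |a|) +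
            fun s => s ^ α * ∫ σ in s..1, |deriv (deriv τ) σ|) p μ := by
          apply eLpNorm_mono_ae_real
          filter_upwards [ae_restrict_mem measurableSet_Ioo] with s hs
          have hs0 := hs.1
          have e : deriv τ s = a - ∫ σ in s..1, deriv (deriv τ) σ := by
            rw [intervalIntegral.integral_eq_sub_of_hasDerivAt (fun u _ => h2 u)
              (hc.intervalIntegrable _ _), hτ1]
            ring
          have e2 : |deriv τ s| ≤ |a| + ∫ σ in s..1, |deriv (deriv τ) σ| := by
            rw [e]
            refine (abs_sub _ _).trans ?_
            gcongr
            exact intervalIntegral.abs_integral_le_integral_abs hs.2.le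
          rw [Real.norm_eq_abs, abs_mul, abs_of_nonneg (by positivity : 0 ≤ s ^ α)]
          simp only [Pi.add_apply]
          rw [← mul_add]
          gcongr
      _ ≤ eLpNorm (fun s => s ^ α * |a|) p μ +
            eLpNorm (fun s => s ^ α * ∫ σ in s..1, |deriv (deriv τ) σ|) p μ := by
          apply eLpNorm_add_le _ _ hp
          · exact (hαc.mul continuous_const).aestronglyMeasurable
          · exact (hαc.mul hF1).aestronglyMeasurable
      _ ≤ ENNReal.ofReal |a| + 2 * ENNReal.ofReal (I + M ^ 2 * (|a| + I)) := by
          gcongr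
          · have := eLpNorm_le_of_ae_bound (p := p) (μ := μ) (f := fun s => s ^ α * |a|)
              (C := |a|) (by
                filter_upwards [ae_restrict_mem measurableSet_Ioo] with s hs
                have hs0 := hs.1
                rw [Real.norm_of_nonneg (by positivity)]
                exact mul_le_of_le_one_left (abs_nonneg _)
                  (Real.rpow_le_one hs0.le hs.2.le hα))
            simpa [hμ] using this
          · refine (aux_hardy_s17 (fun s => |deriv (deriv τ) s|) hc.abs (fun s => abs_nonneg _)
              p α hp hα).trans ?_
            gcongr
      _ ≤ _ := by
          have : (2 : ℝ≥0∞) = ENNReal.ofReal 2 := by simp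
          rw [this, ← ENNReal.ofReal_mul (by positivity),
              ← ENNReal.ofReal_add (by positivity) (by positivity)]
          apply ENNReal.ofReal_le_ofReal
          nlinarith [abs_nonneg a, sq_nonneg M]
end
end

section
/- For every nonnegative integer m there exists a constant C = C(m) > 0 such that for all sufficiently smooth functions u, v on (0,1] with finite norms ‖u‖_{X^{max(m,2)}} and ‖v‖_{X^m}, the pointwise product satisfies ‖uv‖_{X^m} ≤ C ‖u‖_{X^{max(m,2)}} ‖v‖_{X^m}. -/
open MeasureTheory ENNReal RealInnerProductSpace

noncomputable section

/-- Weighted integral with natural exponent. -/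
def JJ (p : ℕ) (f : ℝ → ℝ) : ℝ≥0∞ :=
  ∫⁻ s in Set.Ioo (0:ℝ) 1, ENNReal.ofReal (s ^ p * f s ^ 2)

lemma wL2_sq_s18 (p : ℕ) (α : ℝ) (h : 2 * α = p) (f : ℝ → ℝ) : wL2 α f ^ 2 = JJ p f := by
  unfold wL2 JJ
  rw [← ENNReal.rpow_natCast, ← ENNReal.rpow_mul]
  norm_num
  refine setLIntegral_congr_fun measurableSet_Ioo fun s hs => ?_
  simp only [h, Real.rpow_natCast]

lemma XnormSq_eq (m : ℕ) (u : ℝ → ℝ) :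
    XnormSq m u = ∑ i ∈ Finset.range (m + 1), JJ (2 * i - m) (iteratedDeriv i u) := by
  unfold XnormSq
  split_ifs with h
  · obtain ⟨k, rfl⟩ : ∃ k, m = 2 * k := ⟨m / 2, by omega⟩
    rw [show 2 * k / 2 = k by omega, show 2 * k + 1 = (k + 1) + k by ring,
      Finset.sum_range_add _ (k + 1) k]
    congr 1
    · refine Finset.sum_congr rfl fun i hi => ?_
      rw [Finset.mem_range] at hi
      rw [wL2_sq_s18 (2 * i - 2 * k)]
      rw [show 2 * i - 2 * k = 0 by omega]; simp
    · refine Finset.sum_congr rfl fun j hj => ?_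
      rw [wL2_sq_s18 (2 * (k + 1 + j) - 2 * k), show k + j + 1 = k + 1 + j by ring]
      rw [show 2 * (k + 1 + j) - 2 * k = 2 * (j + 1) by omega]; push_cast; ring
  · obtain ⟨k, rfl⟩ : ∃ k, m = 2 * k + 1 := ⟨m / 2, by omega⟩
    rw [show (2 * k + 1) / 2 = k by omega, show 2 * k + 1 + 1 = (k + 1) + (k + 1) by ring,
      Finset.sum_range_add _ (k + 1) (k + 1)]
    congr 1
    · refine Finset.sum_congr rfl fun i hi => ?_
      rw [Finset.mem_range] at hi
      rw [wL2_sq_s18 (2 * i - (2 * k + 1))]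
      rw [show 2 * i - (2 * k + 1) = 0 by omega]; simp
    · refine Finset.sum_congr rfl fun j hj => ?_
      rw [wL2_sq_s18 (2 * (k + 1 + j) - (2 * k + 1)), show k + j + 1 = k + 1 + j by ring]
      rw [show 2 * (k + 1 + j) - (2 * k + 1) = 2 * j + 1 by omega]; push_cast; ring

lemma JJ_le_XnormSq (m i : ℕ) (hi : i ≤ m) (u : ℝ → ℝ) :
    JJ (2 * i - m) (iteratedDeriv i u) ≤ XnormSq m u := by
  rw [XnormSq_eq]
  exact Finset.single_le_sum (f := fun i => JJ (2 * i - m) (iteratedDeriv i u))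
    (fun _ _ => zero_le) (Finset.mem_range.2 (by omega))

lemma smooth_iter {f : ℝ → ℝ} (hf : ContDiffOn ℝ (⊤ : ℕ∞) f (Set.Ioi 0)) (i : ℕ) :
    ContDiffOn ℝ (⊤ : ℕ∞) (iteratedDeriv i f) (Set.Ioi 0) := by
  induction i with
  | zero => simpa using hf
  | succ i ih =>
    rw [iteratedDeriv_succ]
    exact ih.deriv_of_isOpen isOpen_Ioi (by simp)

lemma meas_aux {f : ℝ → ℝ} (hf : ContinuousOn f (Set.Ioi 0)) (p : ℕ) :
    AEMeasurable (fun s => ENNReal.ofReal (s ^ p * f s ^ 2))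
      (volume.restrict (Set.Ioo (0:ℝ) 1)) := by
  have h : ContinuousOn (fun s => s ^ p * f s ^ 2) (Set.Ioo (0:ℝ) 1) :=
    ((continuous_pow p).continuousOn).mul ((hf.mono fun x hx => hx.1).pow 2)
  exact (h.aemeasurable measurableSet_Ioo).ennreal_ofReal

lemma deriv_bound (p q : ℕ) (hpq : q ≤ p) (hp : p = 0 ∨ q + 1 ≤ p) {x a b : ℝ}
    (h0 : 0 < x) (h1 : x < 1) :
    |p * x ^ (p - 1) * a ^ 2 + x ^ p * (2 * a * b)| ≤ (p + 1) * (x ^ q * a ^ 2 + x ^ p * b ^ 2) := by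
  have e1 : (p : ℝ) * x ^ (p - 1) ≤ p * x ^ q := by
    rcases hp with rfl | hp
    · simp
    · exact mul_le_mul_of_nonneg_left
        (pow_le_pow_of_le_one h0.le h1.le (by omega)) (by positivity)
  have e2 : x ^ p ≤ x ^ q := pow_le_pow_of_le_one h0.le h1.le hpq
  have e3 : |2 * a * b| ≤ a ^ 2 + b ^ 2 := by
    rw [abs_le]; constructor <;> nlinarith [sq_nonneg (a - b), sq_nonneg (a + b)]
  have hx : 0 ≤ x ^ p := by positivity
  have hp' : (0:ℝ) ≤ p * (x ^ p * b ^ 2) := by positivity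
  calc _ ≤ |p * x ^ (p - 1) * a ^ 2| + |x ^ p * (2 * a * b)| := abs_add_le _ _
    _ = p * x ^ (p - 1) * a ^ 2 + x ^ p * |2 * a * b| := by
      rw [abs_of_nonneg (a := p * x ^ (p - 1) * a ^ 2) (by positivity), abs_mul, abs_of_nonneg hx]
    _ ≤ p * x ^ q * a ^ 2 + x ^ p * (a ^ 2 + b ^ 2) := by gcongr
    _ = p * x ^ q * a ^ 2 + (x ^ p * a ^ 2 + x ^ p * b ^ 2) := by ring
    _ ≤ p * x ^ q * a ^ 2 + (x ^ q * a ^ 2 + x ^ p * b ^ 2) := by gcongr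
    _ ≤ _ := by linarith

lemma diff_bound {f : ℝ → ℝ} (hf : ContDiffOn ℝ (⊤ : ℕ∞) f (Set.Ioi 0)) (p q : ℕ)
    (hpq : q ≤ p) (hp : p = 0 ∨ q + 1 ≤ p) {s t : ℝ} (hs : 0 < s) (hst : s ≤ t) (ht : t < 1) :
    ‖t ^ p * f t ^ 2 - s ^ p * f s ^ 2‖ₑ ≤ ((p + 1 : ℕ) : ℝ≥0∞) * (JJ q f + JJ p (deriv f)) := by
  have hF : ContDiffOn ℝ (⊤ : ℕ∞) (fun x => x ^ p * f x ^ 2) (Set.Ioi 0) :=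
    (contDiff_id.pow p).contDiffOn.mul (hf.pow 2)
  have hsub : Set.Icc s t ⊆ Set.Ioi 0 := fun x hx => lt_of_lt_of_le hs hx.1
  have hF1 : ContDiffOn ℝ 1 (fun x => x ^ p * f x ^ 2) (Set.Icc s t) :=
    (hF.mono hsub).of_le (by exact_mod_cast le_top)
  refine (enorm_sub_le_lintegral_deriv_of_contDiffOn_Icc hF1 hst).trans ?_
  have hsub2 : Set.Icc s t ⊆ Set.Ioo 0 1 :=
    fun x hx => ⟨lt_of_lt_of_le hs hx.1, lt_of_le_of_lt hx.2 ht⟩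
  refine (lintegral_mono_set hsub2).trans ?_
  unfold JJ
  rw [← lintegral_add_left' (meas_aux hf.continuousOn q), ← lintegral_const_mul' _ _ (by simp)]
  refine setLIntegral_mono' measurableSet_Ioo fun x hx => ?_
  have hd : HasDerivAt f (deriv f x) x :=
    ((hf.contDiffAt (Ioi_mem_nhds hx.1)).differentiableAt (by simp)).hasDerivAt
  have hD : HasDerivAt (fun x => x ^ p * f x ^ 2)
      (p * x ^ (p - 1) * f x ^ 2 + x ^ p * (2 * f x * deriv f x)) x := by
    have := (hasDerivAt_pow p x).mul (hd.pow 2)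
    refine HasDerivAt.congr_deriv (f := fun x => x ^ p * f x ^ 2) this ?_
    simp
  have hx0 : 0 < x := hx.1
  rw [hD.deriv, ← ENNReal.ofReal_add (by positivity) (by positivity), ← ENNReal.ofReal_natCast,
    ← ENNReal.ofReal_mul (by positivity), Real.enorm_eq_ofReal_abs]
  apply ENNReal.ofReal_le_ofReal
  push_cast
  exact deriv_bound p q hpq hp hx.1 hx.2

lemma sup_bound {f : ℝ → ℝ} (hf : ContDiffOn ℝ (⊤ : ℕ∞) f (Set.Ioi 0)) (p q : ℕ)
    (hpq : q ≤ p) (hp : p = 0 ∨ q + 1 ≤ p) {s : ℝ} (hs : s ∈ Set.Ioo (0:ℝ) 1) :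
    ENNReal.ofReal (s ^ p * f s ^ 2) ≤
      ((p + 2 : ℕ) : ℝ≥0∞) * (JJ q f + JJ p (deriv f)) := by
  set I := JJ q f + JJ p (deriv f) with hI
  have key : ∀ t ∈ Set.Ioo (0:ℝ) 1, ENNReal.ofReal (s ^ p * f s ^ 2) ≤
      ENNReal.ofReal (t ^ q * f t ^ 2) + ((p + 1 : ℕ) : ℝ≥0∞) * I := by
    intro t ht
    have ht0 := ht.1
    have hs0 := hs.1
    have h1 : ‖s ^ p * f s ^ 2 - t ^ p * f t ^ 2‖ₑ ≤ ((p + 1 : ℕ) : ℝ≥0∞) * I := by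
      rcases le_total s t with h | h
      · rw [← enorm_neg, neg_sub]
        exact diff_bound hf p q hpq hp hs.1 h ht.2
      · exact diff_bound hf p q hpq hp ht.1 h hs.2
    refine le_trans ?_ (add_le_add_right h1 _)
    rw [Real.enorm_eq_ofReal_abs, ← ENNReal.ofReal_add (by positivity) (by positivity)]
    apply ENNReal.ofReal_le_ofReal
    have e2 : t ^ p * f t ^ 2 ≤ t ^ q * f t ^ 2 := by
      gcongr ?_ * _
      exact pow_le_pow_of_le_one ht.1.le ht.2.le hpq
    linarith [le_abs_self (s ^ p * f s ^ 2 - t ^ p * f t ^ 2)]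
  have h2 := setLIntegral_mono' (μ := volume) measurableSet_Ioo key
  rw [lintegral_add_right _ measurable_const] at h2
  simp only [lintegral_const, Measure.restrict_apply MeasurableSet.univ, Set.univ_inter,
    Real.volume_Ioo, sub_zero, ENNReal.ofReal_one, mul_one] at h2
  refine h2.trans ?_
  calc _ ≤ I + ((p + 1 : ℕ) : ℝ≥0∞) * I := by
        gcongr
        exact le_self_add
    _ = _ := by push_cast; ring

lemma sup_iter {u : ℝ → ℝ} (hu : ContDiffOn ℝ (⊤ : ℕ∞) u (Set.Ioi 0)) (m i : ℕ) (hi : i + 1 ≤ m)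
    {s : ℝ} (hs : s ∈ Set.Ioo (0:ℝ) 1) :
    ENNReal.ofReal (s ^ (2 * i + 2 - m) * iteratedDeriv i u s ^ 2) ≤
      ((2 * (m + 2) : ℕ) : ℝ≥0∞) * XnormSq m u := by
  refine (sup_bound (smooth_iter hu i) (2 * i + 2 - m) (2 * i - m) (by omega) (by omega) hs).trans ?_
  rw [← iteratedDeriv_succ]
  have h1 := JJ_le_XnormSq m i (by omega) u
  have h2 := JJ_le_XnormSq m (i + 1) (by omega) u
  rw [show 2 * (i + 1) - m = 2 * i + 2 - m by omega] at h2
  calc _ ≤ ((m + 2 : ℕ) : ℝ≥0∞) * (XnormSq m u + XnormSq m u) := by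
        gcongr
        omega
    _ = _ := by push_cast; ring

lemma prod_bound {u : ℝ → ℝ} (hu : ContDiffOn ℝ (⊤ : ℕ∞) u (Set.Ioi 0)) (g : ℝ → ℝ)
    (hg : ContinuousOn g (Set.Ioi 0)) (m i r q : ℕ)
    (hi : i + 1 ≤ m) (hr : (2 * i + 2 - m) + q ≤ r) :
    JJ r (fun s => iteratedDeriv i u s * g s) ≤
      ((2 * (m + 2) : ℕ) : ℝ≥0∞) * (XnormSq m u * JJ q g) := by
  rw [← mul_assoc]
  unfold JJ
  rw [← lintegral_const_mul'' _ (meas_aux hg q)]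
  refine setLIntegral_mono' measurableSet_Ioo fun s hs => ?_
  have hs0 := hs.1
  refine le_trans ?_ (mul_le_mul_left (sup_iter hu m i hi hs) _)
  rw [← ENNReal.ofReal_mul (by positivity)]
  apply ENNReal.ofReal_le_ofReal
  calc _ = s ^ r * (iteratedDeriv i u s ^ 2 * g s ^ 2) := by ring
    _ ≤ s ^ ((2 * i + 2 - m) + q) * (iteratedDeriv i u s ^ 2 * g s ^ 2) := by
        gcongr ?_ * _
        exact pow_le_pow_of_le_one hs.1.le hs.2.le hr
    _ = _ := by rw [pow_add]; ring

lemma term_bound {u v : ℝ → ℝ} (hu : ContDiffOn ℝ (⊤ : ℕ∞) u (Set.Ioi 0))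
    (hv : ContDiffOn ℝ (⊤ : ℕ∞) v (Set.Ioi 0)) (m i l n : ℕ) (hn : i + l = n) (hm : n ≤ m) :
    JJ (2 * n - m) (fun s => iteratedDeriv i u s * iteratedDeriv l v s) ≤
      ((2 * (max m 2 + 2) : ℕ) : ℝ≥0∞) * (XnormSq (max m 2) u * XnormSq m v) := by
  by_cases h : i ≤ l
  · refine (prod_bound hu _ (smooth_iter hv l).continuousOn (max m 2) i _ (2 * l - m)
      (by omega) (by omega)).trans ?_
    gcongr
    exact JJ_le_XnormSq m l (by omega) v
  · have h1 := prod_bound hv _ (smooth_iter hu i).continuousOn m l (2 * n - m) (2 * i - max m 2)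
      (by omega) (by omega)
    simp only [mul_comm (iteratedDeriv l v _)] at h1
    refine h1.trans ?_
    rw [mul_comm (XnormSq m v)]
    gcongr
    · omega
    · exact JJ_le_XnormSq _ i (by omega) u

lemma leib_bound {u v : ℝ → ℝ} (hu : ContDiffOn ℝ (⊤ : ℕ∞) u (Set.Ioi 0))
    (hv : ContDiffOn ℝ (⊤ : ℕ∞) v (Set.Ioi 0)) (r n : ℕ) :
    JJ r (iteratedDeriv n (fun s => u s * v s)) ≤
      ∑ i ∈ Finset.range (n + 1), (((n + 1) * n.choose i ^ 2 : ℕ) : ℝ≥0∞) *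
        JJ r (fun s => iteratedDeriv i u s * iteratedDeriv (n - i) v s) := by
  have hc : ∀ i, ContinuousOn (fun s => iteratedDeriv i u s * iteratedDeriv (n - i) v s)
      (Set.Ioi 0) := fun i => (smooth_iter hu i).continuousOn.mul (smooth_iter hv _).continuousOn
  unfold JJ
  simp only [← lintegral_const_mul'' _ (meas_aux (hc _) r)]
  rw [← lintegral_finsetSum' _ (fun i _ => (meas_aux (hc i) r).const_mul _)]
  refine setLIntegral_mono' measurableSet_Ioo fun s hs => ?_
  have hs0 := hs.1
  have e : iteratedDeriv n (fun s => u s * v s) s = ∑ i ∈ Finset.range (n + 1),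
      n.choose i * iteratedDeriv i u s * iteratedDeriv (n - i) v s :=
    iteratedDeriv_mul ((hu.contDiffAt (Ioi_mem_nhds hs.1)).of_le (by exact_mod_cast le_top))
      ((hv.contDiffAt (Ioi_mem_nhds hs.1)).of_le (by exact_mod_cast le_top))
  simp only [← ENNReal.ofReal_natCast]
  simp only [← ENNReal.ofReal_mul (Nat.cast_nonneg (α := ℝ) _)]
  rw [← ENNReal.ofReal_sum_of_nonneg (fun i _ => by positivity)]
  apply ENNReal.ofReal_le_ofReal
  rw [e]
  refine (mul_le_mul_of_nonneg_left sq_sum_le_card_mul_sum_sq (by positivity)).trans ?_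
  rw [Finset.mul_sum, Finset.mul_sum]
  refine (Finset.sum_congr rfl fun i _ => ?_).le
  rw [Finset.card_range]; push_cast; ring

lemma sq_bound (m : ℕ) : ∃ K : ℕ, ∀ u v : ℝ → ℝ,
      ContDiffOn ℝ (⊤ : ℕ∞) u (Set.Ioi 0) → ContDiffOn ℝ (⊤ : ℕ∞) v (Set.Ioi 0) →
      XnormSq m (fun s => u s * v s) ≤ (K : ℝ≥0∞) * (XnormSq (max m 2) u * XnormSq m v) := by
  refine ⟨∑ n ∈ Finset.range (m + 1), ∑ i ∈ Finset.range (n + 1),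
    ((n + 1) * n.choose i ^ 2) * (2 * (max m 2 + 2)), fun u v hu hv => ?_⟩
  rw [XnormSq_eq, Nat.cast_sum, Finset.sum_mul]
  refine Finset.sum_le_sum fun n hn => ?_
  rw [Nat.cast_sum, Finset.sum_mul]
  refine (leib_bound hu hv _ n).trans (Finset.sum_le_sum fun i hi => ?_)
  rw [Finset.mem_range] at hn hi
  rw [Nat.cast_mul _ (2 * (max m 2 + 2)), mul_assoc]
  gcongr
  exact term_bound hu hv m i (n - i) n (by omega) (by omega)

/-- algebra property `‖uv‖_{X^m} ≤ C ‖u‖_{X^{max(m,2)}} ‖v‖_{X^m}`. -/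
theorem stmt18 (m : ℕ) :
    ∃ C : ℝ, 0 < C ∧ ∀ u v : ℝ → ℝ,
      ContDiffOn ℝ (⊤ : ℕ∞) u (Set.Ioi 0) → ContDiffOn ℝ (⊤ : ℕ∞) v (Set.Ioi 0) →
      Xnorm (max m 2) u ≠ ⊤ → Xnorm m v ≠ ⊤ →
      Xnorm m (fun s => u s * v s) ≤ ENNReal.ofReal C * (Xnorm (max m 2) u * Xnorm m v) := by
  obtain ⟨K, hK⟩ := sq_bound m
  refine ⟨((K : ℝ) + 1) ^ ((1:ℝ) / 2), by positivity, fun u v hu hv _ _ => ?_⟩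
  unfold Xnorm
  rw [← ENNReal.ofReal_rpow_of_nonneg (by positivity) (by norm_num),
    ← ENNReal.mul_rpow_of_nonneg _ _ (by norm_num), ← ENNReal.mul_rpow_of_nonneg _ _ (by norm_num)]
  refine ENNReal.rpow_le_rpow ((hK u v hu hv).trans ?_) (by norm_num)
  gcongr
  rw [← ENNReal.ofReal_natCast]
  exact ENNReal.ofReal_le_ofReal (by linarith)
end
end
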